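/- arXiv:1309.3663 — 2 statements merged into one kernel-verified Lean document; each statement's English description precedes it below -/
import Mathlib

section
/- Let {X_t} be a stationary Markov chain on a finite set A = {1,...,n} with doublet frequency vector μ ∈ M_s(A²) satisfying μ_{ij} > 0 for all i, j. Then for every subset Γ ⊆ M_s(A²), liminf_{l→∞} (1/l) log Pr{ν(x_1^l) ∈ Γ} ≥ −inf_{ζ∈Γ°} D_c(ζ‖μ), where Γ° denotes the interior of Γ relative to M_s(A²) in the ℓ¹ (total variation) metric. -/
open Finset Filter

/-- Marginal of a doublet distribution. -/
def marg {n : ℕ} (ν : Fin n → Fin n → ℝ) : Fin n → ℝ := fun i => ∑ j, ν i j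

def IsProb2 {n : ℕ} (ν : Fin n → Fin n → ℝ) : Prop :=
  (∀ i j, 0 ≤ ν i j) ∧ ∑ i, ∑ j, ν i j = 1

def IsStat2 {n : ℕ} (ν : Fin n → Fin n → ℝ) : Prop :=
  ∀ i, ∑ j, ν i j = ∑ j, ν j i

/-- The set `M_s(A²)` of stationary probability distributions on `A²`. -/
def Ms2 (n : ℕ) : Set (Fin n → Fin n → ℝ) := {ν | IsProb2 ν ∧ IsStat2 ν}

/-- Relative entropy of doublet distributions. -/
noncomputable def DKL2 {n : ℕ} (ν μ : Fin n → Fin n → ℝ) : ℝ :=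
  ∑ i, ∑ j, ν i j * Real.log (ν i j / μ i j)

/-- Relative entropy of probability vectors. -/
noncomputable def DKL1 {n : ℕ} (p q : Fin n → ℝ) : ℝ := ∑ i, p i * Real.log (p i / q i)

/-- Conditional relative entropy `D_c(ν‖μ) = D(ν‖μ) − D(ν̄‖μ̄)`. -/
noncomputable def Dc {n : ℕ} (ν μ : Fin n → Fin n → ℝ) : ℝ :=
  DKL2 ν μ - DKL1 (marg ν) (marg μ)

/-- Cyclic empirical doublet measure of a sample path of length `l = m+1`. -/
noncomputable def emp2 {n m : ℕ} (x : Fin (m+1) → Fin n) : Fin n → Fin n → ℝ :=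
  fun i j => (∑ t : Fin (m+1), if x t = i ∧ x (t+1) = j then (1:ℝ) else 0) / (m+1)

/-- Markov chain law on paths of length `l = m+1`. -/
noncomputable def pathP {n : ℕ} (μ : Fin n → Fin n → ℝ) {m : ℕ} (x : Fin (m+1) → Fin n) : ℝ :=
  marg μ (x 0) * ∏ t : Fin m, (μ (x t.castSucc) (x t.succ) / marg μ (x t.castSucc))

open scoped Classical in
/-- `Pr{ν(x_1^l) ∈ Γ}`: probability of the set of sample paths of length `l = m+1`
whose cyclic empirical doublet measure lies in `Γ`. -/
noncomputable def prEvent {n : ℕ} (μ : Fin n → Fin n → ℝ) (m : ℕ)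
    (Γ : Set (Fin n → Fin n → ℝ)) : ℝ :=
  ∑ x : Fin (m+1) → Fin n, if emp2 x ∈ Γ then pathP μ x else 0

/-- Extended-real logarithm, `elog p = −∞` for `p ≤ 0`. -/
noncomputable def elog (p : ℝ) : EReal := if p ≤ 0 then ⊥ else ((Real.log p : ℝ) : EReal)


/-- ℓ¹ (total variation) distance between doublet distributions. -/
def dist1 {n : ℕ} (ν ξ : Fin n → Fin n → ℝ) : ℝ := ∑ i, ∑ j, |ν i j - ξ i j|

/-- The interior of `Γ` relative to `S` in the ℓ¹ metric. -/
def relInt {n : ℕ} (S Γ : Set (Fin n → Fin n → ℝ)) : Set (Fin n → Fin n → ℝ) :=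
  {ζ | ζ ∈ Γ ∧ ∃ ε > 0, ∀ ξ ∈ S, dist1 ξ ζ < ε → ξ ∈ Γ}

lemma sum_snoc {α : Type*} [Fintype α] {m : ℕ} (f : (Fin (m+2) → α) → ℝ) :
    ∑ x, f x = ∑ x : Fin (m+1) → α, ∑ b, f (Fin.snoc x b) := by
  rw [← (Fin.snocEquiv (fun _ : Fin (m+2) => α)).sum_comp, Fintype.sum_prod_type, Finset.sum_comm]
  rfl

lemma pathP_snoc {n m : ℕ} (μ : Fin n → Fin n → ℝ) (x : Fin (m+1) → Fin n) (b : Fin n) :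
    pathP μ (Fin.snoc x b : Fin (m+2) → Fin n)
      = pathP μ x * (μ (x (Fin.last m)) b / marg μ (x (Fin.last m))) := by
  unfold pathP
  rw [Fin.prod_univ_castSucc, ← mul_assoc]
  have h0 : (Fin.snoc x b : Fin (m+2) → Fin n) 0 = x 0 := by
    rw [← Fin.castSucc_zero, Fin.snoc_castSucc (α := fun _ => Fin n)]
  simp only [h0, Fin.snoc_castSucc (α := fun _ => Fin n), Fin.succ_last,
    Fin.snoc_last (α := fun _ => Fin n), Fin.succ_castSucc]

/-- Sum of a doublet function along the consecutive (non-cyclic) pairs of a path. -/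
def pairSum {n m : ℕ} (F : Fin n → Fin n → ℝ) (x : Fin (m+1) → Fin n) : ℝ :=
  ∑ t : Fin m, F (x t.castSucc) (x t.succ)

lemma pairSum_snoc {n m : ℕ} (F : Fin n → Fin n → ℝ) (x : Fin (m+1) → Fin n) (b : Fin n) :
    pairSum F (Fin.snoc x b : Fin (m+2) → Fin n) = pairSum F x + F (x (Fin.last m)) b := by
  unfold pairSum
  rw [Fin.sum_univ_castSucc]
  simp only [Fin.snoc_castSucc (α := fun _ => Fin n), Fin.succ_last,
    Fin.snoc_last (α := fun _ => Fin n), Fin.succ_castSucc]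

lemma marg_pos {n : ℕ} {μ : Fin n → Fin n → ℝ} (hpos : ∀ i j, 0 < μ i j) (i : Fin n) :
    0 < marg μ i :=
  Finset.sum_pos (fun j _ => hpos i j) ⟨i, Finset.mem_univ i⟩

lemma pathP_pos {n m : ℕ} {μ : Fin n → Fin n → ℝ} (hpos : ∀ i j, 0 < μ i j)
    (x : Fin (m+1) → Fin n) : 0 < pathP μ x :=
  mul_pos (marg_pos hpos _)
    (Finset.prod_pos fun _ _ => div_pos (hpos _ _) (marg_pos hpos _))

lemma sum_transition {n : ℕ} {μ : Fin n → Fin n → ℝ} (hpos : ∀ i j, 0 < μ i j) (i : Fin n) :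
    ∑ j, μ i j / marg μ i = 1 := by
  rw [← Finset.sum_div]
  exact div_self (marg_pos hpos i).ne'

lemma sum_pathP_zero {n : ℕ} (μ : Fin n → Fin n → ℝ) (F : (Fin 1 → Fin n) → ℝ) :
    ∑ x : Fin (0+1) → Fin n, pathP μ x * F x = ∑ i, marg μ i * F (fun _ => i) := by
  rw [← (Equiv.funUnique (Fin 1) (Fin n)).symm.sum_comp]
  simp [pathP, Equiv.funUnique]
  rfl

lemma sum_pathP {n : ℕ} {μ : Fin n → Fin n → ℝ} (hμ : IsProb2 μ) (hpos : ∀ i j, 0 < μ i j)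
    (m : ℕ) : ∑ x : Fin (m+1) → Fin n, pathP μ x = 1 := by
  induction m with
  | zero => simpa [hμ.2] using (sum_pathP_zero μ (fun _ => 1)).trans (by simpa [marg] using hμ.2)
  | succ m ih =>
    rw [sum_snoc, ← ih]
    refine Finset.sum_congr rfl fun x _ => ?_
    simp_rw [pathP_snoc]
    rw [← Finset.mul_sum, sum_transition hpos, mul_one]

/-- Second moment bound for sums of bounded martingale differences along the chain. -/
lemma sum_pathP_mul_pairSum_sq_le {n : ℕ} {μ : Fin n → Fin n → ℝ} (hμ : IsProb2 μ)
    (hpos : ∀ i j, 0 < μ i j) {M : Fin n → Fin n → ℝ}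
    (hM0 : ∀ a, ∑ b, μ a b / marg μ a * M a b = 0) (hM1 : ∀ a b, M a b ^ 2 ≤ 1) (m : ℕ) :
    ∑ x : Fin (m+1) → Fin n, pathP μ x * pairSum M x ^ 2 ≤ m := by
  induction m with
  | zero => simp [pairSum]
  | succ m ih =>
    rw [sum_snoc]
    have key : ∀ x : Fin (m+1) → Fin n,
        ∑ b, pathP μ (Fin.snoc x b : Fin (m+2) → Fin n)
            * pairSum M (Fin.snoc x b : Fin (m+2) → Fin n) ^ 2
          ≤ pathP μ x * pairSum M x ^ 2 + pathP μ x := by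
      intro x
      simp_rw [pathP_snoc, pairSum_snoc]
      set a := x (Fin.last m)
      have h1 : ∑ b, μ a b / marg μ a * M a b ^ 2 ≤ 1 := by
        rw [← sum_transition hpos a]
        exact Finset.sum_le_sum fun b _ =>
          mul_le_of_le_one_right (div_pos (hpos _ _) (marg_pos hpos _)).le (hM1 a b)
      have h2 : ∑ b, pathP μ x * (μ a b / marg μ a) * (pairSum M x + M a b) ^ 2
          = pathP μ x * (pairSum M x ^ 2 * ∑ b, μ a b / marg μ a)
            + pathP μ x * (2 * pairSum M x * ∑ b, μ a b / marg μ a * M a b)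
            + pathP μ x * ∑ b, μ a b / marg μ a * M a b ^ 2 := by
        simp only [Finset.mul_sum, ← Finset.sum_add_distrib]
        exact Finset.sum_congr rfl fun b _ => by ring
      rw [h2, hM0, sum_transition hpos]
      nlinarith [pathP_pos hpos x]
    calc _ ≤ ∑ x : Fin (m+1) → Fin n, (pathP μ x * pairSum M x ^ 2 + pathP μ x) :=
          Finset.sum_le_sum fun x _ => key x
      _ ≤ _ := by
          rw [Finset.sum_add_distrib, sum_pathP hμ hpos]
          push_cast
          linarith

lemma sum_emp2_mul {n m : ℕ} (x : Fin (m+1) → Fin n) (F : Fin n → Fin n → ℝ) :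
    ∑ i, ∑ j, emp2 x i j * F i j = (∑ t, F (x t) (x (t+1))) / (m+1) := by
  unfold emp2
  simp_rw [div_mul_eq_mul_div, ← Finset.sum_div, Finset.sum_mul]
  congr 1
  have : ∀ i, ∑ j, ∑ t, (if x t = i ∧ x (t+1) = j then (1:ℝ) else 0) * F i j
      = ∑ t, if x t = i then F i (x (t+1)) else 0 := by
    intro i
    rw [Finset.sum_comm]
    refine Finset.sum_congr rfl fun t _ => ?_
    by_cases h : x t = i <;> simp [h]
  simp_rw [this]
  rw [Finset.sum_comm]
  simp

lemma sum_cyclic {n m : ℕ} (x : Fin (m+1) → Fin n) (F : Fin n → Fin n → ℝ) :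
    ∑ t, F (x t) (x (t+1)) = pairSum F x + F (x (Fin.last m)) (x 0) := by
  rw [Fin.sum_univ_castSucc, pairSum]
  simp

lemma marg_emp2 {n m : ℕ} (x : Fin (m+1) → Fin n) (i : Fin n) :
    marg (emp2 x) i = (∑ t, if x t = i then (1:ℝ) else 0) / (m+1) := by
  rw [← sum_emp2_mul x (fun a _ => if a = i then 1 else 0)]
  simp [marg]

lemma emp2_mem_Ms2 {n m : ℕ} (x : Fin (m+1) → Fin n) : emp2 x ∈ Ms2 n := by
  refine ⟨⟨fun i j => ?_, ?_⟩, fun i => ?_⟩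
  · unfold emp2; positivity
  · have := sum_emp2_mul x (fun _ _ => 1)
    simp only [mul_one] at this
    rw [this]
    have h : (m:ℝ) + 1 ≠ 0 := by positivity
    simp [h]
  · refine (marg_emp2 x i).trans ?_
    have := sum_emp2_mul x (fun _ b => if b = i then 1 else 0)
    simp only [mul_ite, mul_one, mul_zero, Finset.sum_ite_eq', Finset.mem_univ, if_true] at this
    rw [this]
    congr 1
    exact (Equiv.sum_comp (Equiv.addRight (1 : Fin (m+1)))
      (fun t => if x t = i then (1:ℝ) else 0)).symm

lemma continuous_Dc {n : ℕ} {μ : Fin n → Fin n → ℝ} (hpos : ∀ i j, 0 < μ i j) :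
    Continuous fun ζ => Dc ζ μ := by
  have h : ∀ c : ℝ, 0 < c → Continuous fun x : ℝ => x * Real.log (x / c) := by
    intro c hc
    have := (Real.continuous_mul_log.comp (continuous_id.div_const c)).const_mul c
    refine this.congr fun x => ?_
    simp only [Function.comp, id]
    field_simp
  unfold Dc DKL2 DKL1
  refine .sub ?_ ?_
  · exact continuous_finsetSum _ fun i _ => continuous_finsetSum _ fun j _ =>
      (h _ (hpos i j)).comp (by fun_prop : Continuous fun ζ : Fin n → Fin n → ℝ => ζ i j)
  · exact continuous_finsetSum _ fun i _ =>
      (h _ (marg_pos hpos i)).comp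
        (by unfold marg; fun_prop : Continuous fun ζ : Fin n → Fin n → ℝ => marg ζ i)

lemma Dc_eq {n : ℕ} {ζ μ : Fin n → Fin n → ℝ} (hζ : ∀ i j, 0 < ζ i j) (hpos : ∀ i j, 0 < μ i j) :
    Dc ζ μ = ∑ i, ∑ j, ζ i j * Real.log ((ζ i j / marg ζ i) / (μ i j / marg μ i)) := by
  have : DKL1 (marg ζ) (marg μ) = ∑ i, ∑ j, ζ i j * Real.log (marg ζ i / marg μ i) := by
    simp_rw [← Finset.sum_mul]
    rfl
  rw [Dc, this, DKL2, ← Finset.sum_sub_distrib]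
  refine Finset.sum_congr rfl fun i _ => ?_
  rw [← Finset.sum_sub_distrib]
  refine Finset.sum_congr rfl fun j _ => ?_
  have h1 := hζ i j
  have h2 := hpos i j
  have h3 := marg_pos hζ i
  have h4 := marg_pos hpos i
  rw [← mul_sub, ← Real.log_div (by positivity) (by positivity)]
  congr 2
  field_simp

lemma transition_le_one {n : ℕ} {μ : Fin n → Fin n → ℝ} (hpos : ∀ i j, 0 < μ i j) (i j : Fin n) :
    μ i j / marg μ i ≤ 1 := by
  rw [← sum_transition hpos i]
  exact Finset.single_le_sum (f := fun j => μ i j / marg μ i)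
    (fun b _ => (div_pos (hpos _ _) (marg_pos hpos _)).le) (Finset.mem_univ j)

/-- The empirical doublet measure is close in mean square to its marginal times the
transition matrix. -/
lemma sum_pathP_mul_dev_sq_le {n : ℕ} {μ : Fin n → Fin n → ℝ} (hμ : IsProb2 μ)
    (hpos : ∀ i j, 0 < μ i j) (m : ℕ) (i j : Fin n) :
    ∑ x : Fin (m+1) → Fin n,
      pathP μ x * (emp2 x i j - marg (emp2 x) i * (μ i j / marg μ i)) ^ 2 ≤ 2 / (m+1) := by
  set M : Fin n → Fin n → ℝ := fun a b =>
    (if a = i then 1 else 0) * ((if b = j then 1 else 0) - μ i j / marg μ i) with hM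
  have hw0 : 0 < μ i j / marg μ i := div_pos (hpos _ _) (marg_pos hpos _)
  have hw1 := transition_le_one hpos i j
  have hM0 : ∀ a, ∑ b, μ a b / marg μ a * M a b = 0 := by
    intro a
    by_cases h : a = i
    · subst h
      simp only [hM, if_true, one_mul, mul_sub, Finset.sum_sub_distrib, ← Finset.sum_mul,
        sum_transition hpos]
      simp
    · simp [hM, h]
  have hM1 : ∀ a b, M a b ^ 2 ≤ 1 := by
    intro a b
    simp only [hM]
    split_ifs <;> nlinarith
  have hm : (0:ℝ) < m + 1 := by positivity
  have hdev : ∀ x : Fin (m+1) → Fin n,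
      emp2 x i j - marg (emp2 x) i * (μ i j / marg μ i)
        = (pairSum M x + M (x (Fin.last m)) (x 0)) / (m+1) := by
    intro x
    rw [← sum_cyclic, ← sum_emp2_mul, Finset.sum_eq_single i]
    · simp [hM, mul_sub, Finset.sum_sub_distrib, ← Finset.sum_mul, marg]
    · intro a _ h
      simp [hM, h]
    · simp
  have hle : ∀ x : Fin (m+1) → Fin n,
      pathP μ x * (emp2 x i j - marg (emp2 x) i * (μ i j / marg μ i)) ^ 2
        ≤ (2 * (pathP μ x * pairSum M x ^ 2) + 2 * pathP μ x) / (m+1)^2 := by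
    intro x
    rw [hdev, div_pow, ← mul_div_assoc]
    gcongr
    nlinarith [pathP_pos hpos x, hM1 (x (Fin.last m)) (x 0),
      sq_nonneg (pairSum M x - M (x (Fin.last m)) (x 0)),
      mul_nonneg (pathP_pos hpos x).le (sq_nonneg (pairSum M x - M (x (Fin.last m)) (x 0))),
      mul_nonneg (pathP_pos hpos x).le (sub_nonneg.2 (hM1 (x (Fin.last m)) (x 0)))]
  refine (Finset.sum_le_sum fun x _ => hle x).trans ?_
  rw [← Finset.sum_div, Finset.sum_add_distrib, ← Finset.mul_sum, ← Finset.mul_sum,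
    sum_pathP hμ hpos, div_le_div_iff₀ (by positivity) hm]
  nlinarith [sum_pathP_mul_pairSum_sq_le hμ hpos hM0 hM1 m]

lemma dist1_le_of_dev_le {n : ℕ} {ν ζ : Fin n → Fin n → ℝ} (hν : ν ∈ Ms2 n) (hζ : ζ ∈ Ms2 n)
    (hpos : ∀ i j, 0 < ζ i j) {a η : ℝ} (ha : 0 < a) (haζ : ∀ i j, a ≤ ζ i j / marg ζ i)
    (hη : ∀ i j, |ν i j - marg ν i * (ζ i j / marg ζ i)| ≤ η) :
    dist1 ν ζ ≤ (n:ℝ) ^ 2 * η * (1 + 1 / a) := by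
  have hn : (1:ℝ) ≤ n := by
    rcases Nat.eq_zero_or_pos n with rfl | h
    · simpa using hζ.1.2
    · exact_mod_cast h
  set W : Fin n → Fin n → ℝ := fun i j => ζ i j / marg ζ i with hW
  set e : Fin n → Fin n → ℝ := fun i j => ν i j - marg ν i * W i j with he
  set d : Fin n → ℝ := fun i => marg ν i - marg ζ i with hd
  have hdiff : ∀ i j, ν i j - ζ i j = e i j + d i * W i j := by
    intro i j
    have : marg ζ i * W i j = ζ i j := mul_div_cancel₀ _ (marg_pos hpos i).ne'
    simp only [he, hd]
    linarith
  have hd0 : ∑ i, d i = 0 := by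
    simp only [hd, Finset.sum_sub_distrib]
    exact sub_eq_zero.2 (hν.1.2.trans hζ.1.2.symm)
  have hdj : ∀ j, |d j| ≤ ∑ i, |e i j| + ∑ i, |d i| * (W i j - a) := by
    intro j
    have h1 : d j = ∑ i, (e i j + d i * (W i j - a)) := by
      have h2 : d j = ∑ i, (ν i j - ζ i j) := by
        rw [Finset.sum_sub_distrib, ← hν.2 j, ← hζ.2 j]
        rfl
      have h3 : ∑ i, d i * a = 0 := by rw [← Finset.sum_mul, hd0, zero_mul]
      rw [h2, ← sub_zero (∑ i, (ν i j - ζ i j)), ← h3, ← Finset.sum_sub_distrib]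
      exact Finset.sum_congr rfl fun i _ => by rw [hdiff]; ring
    rw [h1, ← Finset.sum_add_distrib]
    refine (Finset.abs_sum_le_sum_abs _ _).trans (Finset.sum_le_sum fun i _ => ?_)
    refine (abs_add_le _ _).trans ?_
    rw [abs_mul, abs_of_nonneg (sub_nonneg.2 (haζ i j))]
  have hrow : ∀ i, ∑ j, W i j = 1 := sum_transition hpos
  set E := ∑ i, ∑ j, |e i j|
  set D := ∑ i, |d i|
  have hD0 : 0 ≤ D := Finset.sum_nonneg fun _ _ => abs_nonneg _
  have hE : E ≤ (n:ℝ) ^ 2 * η := by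
    calc E ≤ ∑ i : Fin n, ∑ j : Fin n, η :=
          Finset.sum_le_sum fun i _ => Finset.sum_le_sum fun j _ => hη i j
      _ = _ := by simp; ring
  have hDE : D ≤ E + D * (1 - n * a) := by
    calc D ≤ ∑ j, (∑ i, |e i j| + ∑ i, |d i| * (W i j - a)) :=
          Finset.sum_le_sum fun j _ => hdj j
      _ = _ := by
        rw [Finset.sum_add_distrib, Finset.sum_comm]
        congr 1
        rw [Finset.sum_comm, Finset.sum_mul]
        refine Finset.sum_congr rfl fun i _ => ?_
        rw [← Finset.mul_sum, Finset.sum_sub_distrib, hrow]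
        simp
  have hDa : D ≤ E / a := by
    rw [le_div_iff₀ ha]
    nlinarith [mul_nonneg hD0 ha.le]
  calc dist1 ν ζ ≤ ∑ i, ∑ j, (|e i j| + |d i| * W i j) :=
        Finset.sum_le_sum fun i _ => Finset.sum_le_sum fun j _ => by
          rw [hdiff]
          refine (abs_add_le _ _).trans ?_
          rw [abs_mul, abs_of_nonneg (ha.le.trans (haζ i j))]
    _ = E + D := by simp [Finset.sum_add_distrib, ← Finset.mul_sum, hrow, E, D]
    _ ≤ E * (1 + 1 / a) := by rw [mul_add, mul_one, mul_one_div]; linarith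
    _ ≤ _ := by gcongr

lemma exists_pos_forall_le {ι : Type*} [Finite ι] (f : ι → ℝ) (hf : ∀ i, 0 < f i) :
    ∃ c > 0, ∀ i, c ≤ f i := by
  cases isEmpty_or_nonempty ι
  · exact ⟨1, one_pos, fun i => isEmptyElim i⟩
  · obtain ⟨i, hi⟩ := Finite.exists_min f
    exact ⟨f i, hf i, hi⟩

/-- Log-likelihood ratio of the transition probabilities of two chains. -/
noncomputable def logRatio {n : ℕ} (ζ μ : Fin n → Fin n → ℝ) : Fin n → Fin n → ℝ := fun i j =>
  Real.log ((ζ i j / marg ζ i) / (μ i j / marg μ i))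

lemma exists_mul_pathP_le {n : ℕ} {ζ μ : Fin n → Fin n → ℝ} (hζ : ∀ i j, 0 < ζ i j)
    (hpos : ∀ i j, 0 < μ i j) :
    ∃ c > 0, ∀ (m : ℕ) (x : Fin (m+1) → Fin n),
      pathP ζ x * (c * Real.exp (-((m+1) * ∑ i, ∑ j, emp2 x i j * logRatio ζ μ i j)))
        ≤ pathP μ x := by
  obtain ⟨c, hc, hcle⟩ := exists_pos_forall_le
    (fun p : Fin n × Fin n => marg μ p.1 / marg ζ p.1 * Real.exp (logRatio ζ μ p.2 p.1))
    (fun p => mul_pos (div_pos (marg_pos hpos _) (marg_pos hζ _)) (Real.exp_pos _))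
  refine ⟨c, hc, fun m x => ?_⟩
  have hm : (m:ℝ) + 1 ≠ 0 := by positivity
  have hP : pathP μ x
      = pathP ζ x * (marg μ (x 0) / marg ζ (x 0) * Real.exp (-pairSum (logRatio ζ μ) x)) := by
    rw [Real.exp_neg, pairSum, Real.exp_sum, ← Finset.prod_inv_distrib]
    unfold pathP
    rw [mul_mul_mul_comm, mul_div_cancel₀ _ (marg_pos hζ _).ne', ← Finset.prod_mul_distrib]
    congr 1
    refine Finset.prod_congr rfl fun t _ => ?_
    have h1 := hζ (x t.castSucc) (x t.succ)
    have h2 := hpos (x t.castSucc) (x t.succ)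
    have h3 := marg_pos hζ (x t.castSucc)
    have h4 := marg_pos hpos (x t.castSucc)
    rw [logRatio, Real.exp_log (by positivity)]
    field_simp
  rw [sum_emp2_mul, mul_div_cancel₀ _ hm, sum_cyclic, hP, neg_add, add_comm, Real.exp_add,
    ← mul_assoc c]
  refine mul_le_mul_of_nonneg_left ?_ (pathP_pos hζ x).le
  refine mul_le_mul_of_nonneg_right ?_ (Real.exp_pos _).le
  rw [Real.exp_neg, ← div_eq_mul_inv, div_le_iff₀ (Real.exp_pos _)]
  exact hcle (x 0, x (Fin.last m))

open scoped Classical in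
/-- Weak law of large numbers for the empirical doublet measure. -/
lemma eventually_half_le_sum_pathP {n : ℕ} {ζ : Fin n → Fin n → ℝ} (hζ : ζ ∈ Ms2 n)
    (hpos : ∀ i j, 0 < ζ i j) {δ : ℝ} (hδ : 0 < δ) :
    ∀ᶠ m : ℕ in atTop,
      1 / 2 ≤ ∑ x : Fin (m+1) → Fin n, if dist1 (emp2 x) ζ < δ then pathP ζ x else 0 := by
  obtain ⟨a, ha, hale⟩ := exists_pos_forall_le
    (fun p : Fin n × Fin n => ζ p.1 p.2 / marg ζ p.1)
    (fun p => div_pos (hpos _ _) (marg_pos hpos _))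
  set η : ℝ := δ / (2 * ((n:ℝ) ^ 2 + 1) * (1 + 1 / a)) with hη
  have hη0 : 0 < η := by positivity
  have hsmall : (n:ℝ) ^ 2 * η * (1 + 1 / a) < δ := by
    have : (2 * ((n:ℝ) ^ 2 + 1) * (1 + 1 / a)) * η = δ := by
      rw [hη]; field_simp
    have h2 : 0 < η * (1 + 1 / a) := by positivity
    nlinarith [mul_nonneg (sq_nonneg (n:ℝ)) h2.le]
  have hlim : Tendsto (fun m : ℕ => (n:ℝ)^2 * (2 / η ^ 2) * (1 / ((m:ℝ) + 1))) atTop (nhds 0) := by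
    simpa only [mul_zero] using
      (tendsto_one_div_add_atTop_nhds_zero_nat (𝕜 := ℝ)).const_mul ((n:ℝ)^2 * (2 / η ^ 2))
  filter_upwards [hlim.eventually_le_const (by norm_num : (0:ℝ) < 1 / 2)] with m hm
  set e : (Fin (m+1) → Fin n) → Fin n → Fin n → ℝ := fun x i j =>
    emp2 x i j - marg (emp2 x) i * (ζ i j / marg ζ i) with he
  have hx : ∀ x : Fin (m+1) → Fin n, pathP ζ x - ∑ i, ∑ j, pathP ζ x * e x i j ^ 2 / η ^ 2
      ≤ if dist1 (emp2 x) ζ < δ then pathP ζ x else 0 := by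
    intro x
    have hP := pathP_pos hpos x
    have hterm : ∀ i j, 0 ≤ pathP ζ x * e x i j ^ 2 / η ^ 2 := fun i j => by positivity
    split_ifs with h
    · exact sub_le_self _ (Finset.sum_nonneg fun i _ => Finset.sum_nonneg fun j _ => hterm i j)
    · obtain ⟨i, j, hij⟩ : ∃ i j, η < |e x i j| := by
        by_contra! hcon
        exact h ((dist1_le_of_dev_le (emp2_mem_Ms2 x) hζ hpos ha
          (fun i j => hale (i, j)) hcon).trans_lt hsmall)
      have h1 : pathP ζ x ≤ pathP ζ x * e x i j ^ 2 / η ^ 2 := by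
        rw [le_div_iff₀ (by positivity), ← sq_abs (e x i j)]
        gcongr
      have h2 : pathP ζ x * e x i j ^ 2 / η ^ 2 ≤ ∑ j, pathP ζ x * e x i j ^ 2 / η ^ 2 :=
        Finset.single_le_sum (f := fun j => pathP ζ x * e x i j ^ 2 / η ^ 2)
          (fun j _ => hterm i j) (Finset.mem_univ j)
      have h3 : ∑ j, pathP ζ x * e x i j ^ 2 / η ^ 2
          ≤ ∑ i, ∑ j, pathP ζ x * e x i j ^ 2 / η ^ 2 :=
        Finset.single_le_sum (f := fun i => ∑ j, pathP ζ x * e x i j ^ 2 / η ^ 2)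
          (fun i _ => Finset.sum_nonneg fun j _ => hterm i j) (Finset.mem_univ i)
      linarith
  have hsum : ∑ x : Fin (m+1) → Fin n, ∑ i, ∑ j, pathP ζ x * e x i j ^ 2 / η ^ 2 ≤ 1 / 2 := by
    refine le_trans ?_ hm
    calc _ = ∑ i, ∑ j, (∑ x : Fin (m+1) → Fin n, pathP ζ x * e x i j ^ 2) / η ^ 2 := by
          rw [Finset.sum_comm]
          refine Finset.sum_congr rfl fun i _ => ?_
          rw [Finset.sum_comm]
          simp_rw [Finset.sum_div]
      _ ≤ ∑ i : Fin n, ∑ j : Fin n, (2 / ((m:ℝ)+1)) / η ^ 2 := by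
          gcongr with i _ j _
          exact sum_pathP_mul_dev_sq_le hζ.1 hpos m i j
      _ = _ := by
          simp
          ring
  calc (1:ℝ) / 2 ≤ ∑ x : Fin (m+1) → Fin n,
        (pathP ζ x - ∑ i, ∑ j, pathP ζ x * e x i j ^ 2 / η ^ 2) := by
        rw [Finset.sum_sub_distrib, sum_pathP hζ.1 hpos]
        linarith
    _ ≤ _ := Finset.sum_le_sum fun x _ => hx x

/-- Exponential lower bound on the probability of a neighbourhood of a positive stationary
doublet distribution. -/
lemma exists_eventually_le_prEvent {n : ℕ} {ζ μ : Fin n → Fin n → ℝ} (hζ : ζ ∈ Ms2 n)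
    (hζpos : ∀ i j, 0 < ζ i j) (hpos : ∀ i j, 0 < μ i j) {Γ : Set (Fin n → Fin n → ℝ)}
    {r : ℝ} (hr : 0 < r) (hΓ : ∀ ξ ∈ Ms2 n, dist1 ξ ζ < r → ξ ∈ Γ) {ε : ℝ} (hε : 0 < ε) :
    ∃ c > 0, ∀ᶠ m : ℕ in atTop, c * Real.exp (-((m+1) * (Dc ζ μ + ε))) ≤ prEvent μ m Γ := by
  obtain ⟨c, hc, hcle⟩ := exists_mul_pathP_le hζpos hpos
  set B := ∑ i, ∑ j, |logRatio ζ μ i j| with hB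
  have hB0 : 0 ≤ B := by positivity
  have hBle : ∀ i j, |logRatio ζ μ i j| ≤ B := fun i j =>
    (Finset.single_le_sum (f := fun j => |logRatio ζ μ i j|)
      (fun j _ => abs_nonneg _) (Finset.mem_univ j)).trans
    (Finset.single_le_sum (f := fun i => ∑ j, |logRatio ζ μ i j|)
      (fun i _ => Finset.sum_nonneg fun j _ => abs_nonneg _) (Finset.mem_univ i))
  set δ := min r (ε / (B + 1))
  have hδ : 0 < δ := lt_min hr (by positivity)
  refine ⟨c * (1 / 2), by positivity, ?_⟩
  filter_upwards [eventually_half_le_sum_pathP hζ hζpos hδ] with m hm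
  set R := c * Real.exp (-((m+1) * (Dc ζ μ + ε))) with hR
  have hR0 : 0 < R := by positivity
  calc c * (1 / 2) * Real.exp (-((m+1) * (Dc ζ μ + ε))) = 1 / 2 * R := by rw [hR]; ring
    _ ≤ _ := mul_le_mul_of_nonneg_right hm hR0.le
    _ ≤ prEvent μ m Γ := by
      rw [Finset.sum_mul, prEvent]
      refine Finset.sum_le_sum fun x _ => ?_
      by_cases h : dist1 (emp2 x) ζ < δ
      · have hx : emp2 x ∈ Γ := hΓ _ (emp2_mem_Ms2 x) (h.trans_le (min_le_left _ _))
        rw [if_pos h, if_pos hx]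
        refine le_trans (mul_le_mul_of_nonneg_left ?_ (pathP_pos hζpos x).le) (hcle m x)
        rw [hR]
        gcongr
        have h1 : ∑ i, ∑ j, emp2 x i j * logRatio ζ μ i j - Dc ζ μ
            = ∑ i, ∑ j, (emp2 x i j - ζ i j) * logRatio ζ μ i j := by
          rw [Dc_eq hζpos hpos]
          simp only [sub_mul, Finset.sum_sub_distrib]
          rfl
        have h2 : ∑ i, ∑ j, (emp2 x i j - ζ i j) * logRatio ζ μ i j ≤ dist1 (emp2 x) ζ * B := by
          rw [dist1, Finset.sum_mul]
          refine Finset.sum_le_sum fun i _ => ?_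
          rw [Finset.sum_mul]
          refine Finset.sum_le_sum fun j _ => ?_
          refine (le_abs_self _).trans ?_
          rw [abs_mul]
          exact mul_le_mul_of_nonneg_left (hBle i j) (abs_nonneg _)
        have h3 : dist1 (emp2 x) ζ < ε / (B + 1) := h.trans_le (min_le_right _ _)
        rw [lt_div_iff₀ (by positivity)] at h3
        have h4 : 0 ≤ dist1 (emp2 x) ζ := by unfold dist1; positivity
        linarith
      · rw [if_neg h, zero_mul]
        split_ifs
        exacts [(pathP_pos hpos x).le, le_rfl]

/-- Mixing with a positive stationary distribution gives positive stationary distributions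
arbitrarily close in `ℓ¹` and with conditional relative entropy arbitrarily close. -/
lemma exists_pos_mem_Ms2_near {n : ℕ} {ζ μ : Fin n → Fin n → ℝ} (hζ : ζ ∈ Ms2 n)
    (hμ : μ ∈ Ms2 n) (hpos : ∀ i j, 0 < μ i j) {ε : ℝ} (hε : 0 < ε) :
    ∃ ξ ∈ Ms2 n, (∀ i j, 0 < ξ i j) ∧ dist1 ξ ζ < ε ∧ Dc ξ μ < Dc ζ μ + ε := by
  set f : ℝ → Fin n → Fin n → ℝ := fun s i j => (1 - s) * ζ i j + s * μ i j with hf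
  have hf0 : f 0 = ζ := by funext i j; simp [hf]
  have hfc : Continuous f := by fun_prop
  have hdist : Continuous fun s => dist1 (f s) ζ := by unfold dist1; fun_prop
  have h1 : ∀ᶠ s in nhds (0:ℝ), dist1 (f s) ζ < ε :=
    hdist.continuousAt.eventually_lt_const (by simpa [hf0, dist1] using hε)
  have h2 : ∀ᶠ s in nhds (0:ℝ), Dc (f s) μ < Dc ζ μ + ε :=
    ((continuous_Dc hpos).comp hfc).continuousAt.eventually_lt_const (by simpa [hf0] using hε)
  have h3 : ∀ᶠ s in nhdsWithin (0:ℝ) (Set.Ioi 0), s ∈ Set.Ioo (0:ℝ) 1 :=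
    Ioo_mem_nhdsGT one_pos
  obtain ⟨s, hs1, hs2, hs0, hs⟩ :=
    ((h1.filter_mono nhdsWithin_le_nhds).and
      ((h2.filter_mono nhdsWithin_le_nhds).and h3)).exists
  have hfs : ∀ i j, 0 < f s i j := fun i j =>
    add_pos_of_nonneg_of_pos (mul_nonneg (by linarith) (hζ.1.1 i j)) (mul_pos hs0 (hpos i j))
  refine ⟨f s, ⟨⟨fun i j => (hfs i j).le, ?_⟩, fun i => ?_⟩, hfs, hs1, hs2⟩
  · simp only [hf, Finset.sum_add_distrib, ← Finset.mul_sum, hζ.1.2, hμ.1.2]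
    ring
  · simp only [hf, Finset.sum_add_distrib, ← Finset.mul_sum, hζ.2 i, hμ.2 i]

lemma dist1_triangle {n : ℕ} (ν ξ ζ : Fin n → Fin n → ℝ) :
    dist1 ν ζ ≤ dist1 ν ξ + dist1 ξ ζ := by
  unfold dist1
  simp only [← Finset.sum_add_distrib]
  exact Finset.sum_le_sum fun i _ => Finset.sum_le_sum fun j _ => abs_sub_le _ _ _

lemma neg_le_inv_mul_elog {c D ε p : ℝ} {m : ℕ} (hc : 0 < c)
    (hp : c * Real.exp (-((m+1) * D)) ≤ p) (hm : -(Real.log c * (1 / ((m:ℝ)+1))) ≤ ε) :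
    ((-(D + ε) : ℝ) : EReal) ≤ ((((m:ℝ)+1)⁻¹ : ℝ) : EReal) * elog p := by
  have hp0 : 0 < p := lt_of_lt_of_le (by positivity) hp
  have hm0 : (0:ℝ) < m + 1 := by positivity
  rw [elog, if_neg hp0.not_ge, ← EReal.coe_mul, EReal.coe_le_coe_iff]
  have hlog : Real.log c - (m+1) * D ≤ Real.log p := by
    have := Real.log_le_log (by positivity) hp
    rwa [Real.log_mul hc.ne' (Real.exp_pos _).ne', Real.log_exp, ← sub_eq_add_neg] at this
  rw [inv_mul_eq_div, le_div_iff₀ hm0]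
  have : Real.log c * (1 / ((m:ℝ)+1)) * (m+1) = Real.log c := by field_simp
  nlinarith

/-- For a stationary Markov chain with strictly positive doublet
frequency vector `μ ∈ M_s(A²)`, for every subset `Γ ⊆ M_s(A²)`,
`liminf_{l→∞} (1/l) log Pr{ν(x_1^l) ∈ Γ} ≥ −inf_{ζ∈Γ°} D_c(ζ‖μ)`, where `Γ°` is the
interior of `Γ` relative to `M_s(A²)` in the ℓ¹ (total variation) metric. -/
theorem stmt11 {n : ℕ} (μ : Fin n → Fin n → ℝ)
    (hμ : μ ∈ Ms2 n) (hpos : ∀ i j, 0 < μ i j)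
    (Γ : Set (Fin n → Fin n → ℝ)) (hΓ : Γ ⊆ Ms2 n) :
    -(⨅ ζ ∈ relInt (Ms2 n) Γ, ((Dc ζ μ : ℝ) : EReal))
      ≤ Filter.liminf
          (fun m : ℕ => ((((m:ℝ)+1)⁻¹ : ℝ) : EReal) * elog (prEvent μ m Γ))
          Filter.atTop := by
  rw [EReal.neg_le]
  refine le_iInf₂ fun ζ hζ => ?_
  rw [EReal.neg_le]
  obtain ⟨hζΓ, r, hr, hrΓ⟩ := hζ
  refine EReal.ge_of_forall_gt_iff_ge.1 fun z hz => ?_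
  rw [← EReal.coe_neg, EReal.coe_lt_coe_iff] at hz
  set ε := min (r / 2) ((-Dc ζ μ - z) / 3)
  have hε : 0 < ε := lt_min (by linarith) (by linarith)
  have hεr : ε ≤ r / 2 := min_le_left _ _
  have hεz : ε ≤ (-Dc ζ μ - z) / 3 := min_le_right _ _
  obtain ⟨ξ, hξ, hξpos, hξζ, hξD⟩ := exists_pos_mem_Ms2_near (hΓ hζΓ) hμ hpos hε
  obtain ⟨c, hc, hev⟩ := exists_eventually_le_prEvent (Γ := Γ) hξ hξpos hpos (half_pos hr)
    (fun ν hν h => hrΓ ν hν (by linarith [dist1_triangle ν ξ ζ])) hε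
  have hlim : Tendsto (fun m : ℕ => -(Real.log c * (1 / ((m:ℝ) + 1)))) atTop (nhds 0) := by
    simpa only [mul_zero, neg_zero] using
      (tendsto_one_div_add_atTop_nhds_zero_nat.const_mul (Real.log c)).neg
  refine le_liminf_of_le (by isBoundedDefault) ?_
  filter_upwards [hev, hlim.eventually_le_const hε] with m h1 h2
  refine le_trans ?_ (neg_le_inv_mul_elog hc h1 h2)
  rw [EReal.coe_le_coe_iff]
  linarith
end

section
/- Let {X_t} be a stationary Markov chain on a finite set A = {1,...,n} whose state transition matrix A = [a_{ij}] is irreducible, and let φ(x_1^l) ∈ S_n be the empirical singleton measure. Then {φ(x_1^l)} satisfies the large deviation property with rate function I(φ) = sup_{u > 0} Σ_{i=1}^n φ_i log(u_i / (uᵀA)_i), and this rate function also equals sup_{u > 0} Σ_{i=1}^n φ_i log(u_i / (Au)_i), where the suprema are over vectors u ∈ ℝ^n with u_i > 0 for all i. -/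
open Finset Filter

/-- The simplex `S_n` of probability vectors. -/
def simplex (n : ℕ) : Set (Fin n → ℝ) := {p | (∀ i, 0 ≤ p i) ∧ ∑ i, p i = 1}

/-- Empirical singleton measure of a sample path of length `l = m+1`. -/
noncomputable def emp1 {n m : ℕ} (x : Fin (m+1) → Fin n) : Fin n → ℝ :=
  fun i => (∑ t : Fin (m+1), if x t = i then (1:ℝ) else 0) / (m+1)

/-- Law of the stationary Markov chain with stationary distribution `π` and transition
matrix `a` on paths of length `l = m+1`:
`Pr{X_1^l = x} = π(x_1) ∏_{t=1}^{l-1} a(x_t, x_{t+1})`. -/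
noncomputable def pathPA {n : ℕ} (π : Fin n → ℝ) (a : Fin n → Fin n → ℝ) {m : ℕ}
    (x : Fin (m+1) → Fin n) : ℝ :=
  π (x 0) * ∏ t : Fin m, a (x t.castSucc) (x t.succ)

open scoped Classical in
/-- `Pr{φ(x_1^l) ∈ Γ}` over paths of length `l = m+1`. -/
noncomputable def prEventA {n : ℕ} (π : Fin n → ℝ) (a : Fin n → Fin n → ℝ) (m : ℕ)
    (Γ : Set (Fin n → ℝ)) : ℝ :=
  ∑ x : Fin (m+1) → Fin n, if emp1 x ∈ Γ then pathPA π a x else 0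

/-- The Donsker–Varadhan rate function
`I(φ) = sup_{u>0} Σ_i φ_i log(u_i/(uᵀA)_i)` (extended-real valued). -/
noncomputable def rateRow {n : ℕ} (a : Fin n → Fin n → ℝ) (φ : Fin n → ℝ) : EReal :=
  ⨆ u ∈ {u : Fin n → ℝ | ∀ i, 0 < u i},
    (((∑ i, φ i * Real.log (u i / ∑ j, u j * a j i)) : ℝ) : EReal)

/-- The variant `I(φ) = sup_{u>0} Σ_i φ_i log(u_i/(Au)_i)`. -/
noncomputable def rateCol {n : ℕ} (a : Fin n → Fin n → ℝ) (φ : Fin n → ℝ) : EReal :=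
  ⨆ u ∈ {u : Fin n → ℝ | ∀ i, 0 < u i},
    (((∑ i, φ i * Real.log (u i / ∑ j, a i j * u j)) : ℝ) : EReal)

/-- ℓ¹ (total variation) distance on probability vectors. -/
def dist1v {n : ℕ} (p q : Fin n → ℝ) : ℝ := ∑ i, |p i - q i|

def OpenInV {n : ℕ} (S Γ : Set (Fin n → ℝ)) : Prop :=
  ∀ ζ ∈ Γ, ∃ ε > 0, ∀ ξ ∈ S, dist1v ξ ζ < ε → ξ ∈ Γ

def ClosedInV {n : ℕ} (S Γ : Set (Fin n → ℝ)) : Prop := OpenInV S (S \ Γ)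


section Duality

variable {n : ℕ}

/-- Every term of the supremum `sup_u Σ φ_i log (u_i / (bu)_i)` is dominated, up to `ε`,
by a term of the corresponding supremum for the transposed matrix. -/
theorem exists_transpose_term_ge (b : Fin n → Fin n → ℝ) (hb : ∀ i j, 0 ≤ b i j)
    (hrow : ∀ i, ∃ j, 0 < b i j) (hcol : ∀ j, ∃ i, 0 < b i j) {φ : Fin n → ℝ}
    (hφ : φ ∈ simplex n) {u : Fin n → ℝ} (hu : ∀ i, 0 < u i) {ε : ℝ} (hε : 0 < ε) :
    ∃ v : Fin n → ℝ, (∀ i, 0 < v i) ∧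
      ∑ i, φ i * Real.log (u i / ∑ j, b i j * u j) ≤
        ∑ i, φ i * Real.log (v i / ∑ j, v j * b j i) + n * ε := by
  obtain ⟨hφ0, hφ1⟩ := hφ
  have hbu : ∀ i, 0 < ∑ j, b i j * u j := fun i => by
    obtain ⟨j, hj⟩ := hrow i
    exact Finset.sum_pos' (fun k _ => mul_nonneg (hb i k) (hu k).le)
      ⟨j, Finset.mem_univ j, mul_pos hj (hu j)⟩
  set v : Fin n → ℝ := fun i => (φ i + ε) / ∑ j, b i j * u j with hv
  have hv0 : ∀ i, 0 < v i := fun i => div_pos (by have := hφ0 i; linarith) (hbu i)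
  have hvb : ∀ j, 0 < ∑ i, v i * b i j := fun j => by
    obtain ⟨i, hi⟩ := hcol j
    exact Finset.sum_pos' (fun k _ => mul_nonneg (hv0 k).le (hb k j))
      ⟨i, Finset.mem_univ i, mul_pos (hv0 i) hi⟩
  refine ⟨v, hv0, ?_⟩
  have htotal : ∑ i, u i * ∑ j, v j * b j i = 1 + n * ε := by
    have : ∑ i, u i * ∑ j, v j * b j i = ∑ j, v j * ∑ i, b j i * u i := by
      simp only [Finset.mul_sum]
      rw [Finset.sum_comm]
      exact Finset.sum_congr rfl fun j _ => Finset.sum_congr rfl fun i _ => by ring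
    rw [this]
    have h2 : ∀ j, v j * ∑ i, b j i * u i = φ j + ε := fun j =>
      div_mul_cancel₀ _ (hbu j).ne'
    simp [h2, Finset.sum_add_distrib, hφ1]
  have hterm : ∀ i, φ i * Real.log (u i / ∑ j, b i j * u j) ≤
      φ i * Real.log (v i / ∑ j, v j * b j i) + (u i * ∑ j, v j * b j i - φ i) := by
    intro i
    rcases (hφ0 i).eq_or_lt with h | h
    · rw [← h]
      have := mul_pos (hu i) (hvb i)
      simp only [zero_mul, zero_add, sub_zero]
      exact this.le
    · have hε' : 0 < φ i + ε := by linarith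
      have h3 : Real.log (u i / ∑ j, b i j * u j) - Real.log (v i / ∑ j, v j * b j i)
          = Real.log (u i * (∑ j, v j * b j i) / (φ i + ε)) := by
        rw [← Real.log_div (div_pos (hu i) (hbu i)).ne' (div_pos (hv0 i) (hvb i)).ne']
        congr 1
        rw [hv]
        have := hbu i
        have := hvb i
        field_simp
      have h4 := Real.log_le_sub_one_of_pos
        (div_pos (mul_pos (hu i) (hvb i)) h)
      have h5 : Real.log (u i * (∑ j, v j * b j i) / (φ i + ε)) ≤
          Real.log (u i * (∑ j, v j * b j i) / φ i) := by
        apply Real.log_le_log (div_pos (mul_pos (hu i) (hvb i)) hε')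
        exact div_le_div_of_nonneg_left (mul_pos (hu i) (hvb i)).le h (by linarith)
      have h6 : φ i * (u i * (∑ j, v j * b j i) / φ i - 1)
          = u i * (∑ j, v j * b j i) - φ i := by field_simp
      have h7 := mul_le_mul_of_nonneg_left (h3.le.trans (h5.trans h4)) h.le
      rw [h6] at h7
      linarith
  calc _ ≤ _ := Finset.sum_le_sum fun i _ => hterm i
    _ = _ := by
      rw [Finset.sum_add_distrib, Finset.sum_sub_distrib, htotal, hφ1]; ring

theorem ereal_le_of_forall_exists_add {x : ℝ} {y : EReal} {c : ℝ}
    (h : ∀ ε > 0, ∃ z : ℝ, (z : EReal) ≤ y ∧ x ≤ z + c * ε) : (x : EReal) ≤ y := by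
  refine EReal.ge_of_forall_gt_iff_ge.1 fun z hz => ?_
  have hz' : z < x := by exact_mod_cast hz
  obtain ⟨w, hw, hx⟩ := h ((x - z) / (|c| + 1)) (div_pos (by linarith) (by positivity))
  refine le_trans ?_ hw
  have h1 : c * ((x - z) / (|c| + 1)) ≤ x - z := by
    rw [mul_div_assoc', div_le_iff₀ (by positivity)]
    nlinarith [le_abs_self c]
  exact_mod_cast (by linarith : z ≤ w)

/-- The row and column forms of the Donsker–Varadhan functional agree. -/
theorem rateRow_eq_rateCol (a : Fin n → Fin n → ℝ) (ha : ∀ i j, 0 ≤ a i j)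
    (hrow : ∀ i, ∃ j, 0 < a i j) (hcol : ∀ j, ∃ i, 0 < a i j) {φ : Fin n → ℝ}
    (hφ : φ ∈ simplex n) : rateRow a φ = rateCol a φ := by
  apply le_antisymm
  · refine iSup₂_le fun u hu => ereal_le_of_forall_exists_add (c := n) fun ε hε => ?_
    obtain ⟨v, hv, h⟩ := exists_transpose_term_ge (fun i j => a j i) (fun i j => ha j i)
      hcol hrow hφ hu hε
    refine ⟨_, le_iSup₂_of_le v hv le_rfl, ?_⟩
    simpa only [mul_comm (a _ _)] using h
  · refine iSup₂_le fun u hu => ereal_le_of_forall_exists_add (c := n) fun ε hε => ?_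
    obtain ⟨v, hv, h⟩ := exists_transpose_term_ge a ha hrow hcol hφ hu hε
    exact ⟨_, le_iSup₂_of_le v hv le_rfl, h⟩

end Duality

section VisitOp

variable {n : ℕ}

/-- The transition operator of the chain that records the current state together with the
numbers of visits to each state before the present time. -/
def visitOp (a : Fin n → Fin n → ℝ) : Module.End ℝ (Fin n → (Fin n → ℕ) → ℝ) where
  toFun F := fun i N => ∑ j, a i j * F j (N + Pi.single i 1)
  map_add' F G := by
    funext i N
    simp [mul_add, Finset.sum_add_distrib]
  map_smul' c F := by
    funext i N
    simp only [Pi.smul_apply, smul_eq_mul, RingHom.id_apply, Finset.mul_sum]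
    exact Finset.sum_congr rfl fun j _ => by ring

variable {a : Fin n → Fin n → ℝ}

theorem visitOp_apply (F : Fin n → (Fin n → ℕ) → ℝ) (i : Fin n) (N : Fin n → ℕ) :
    visitOp a F i N = ∑ j, a i j * F j (N + Pi.single i 1) := rfl

theorem visitOp_pow_succ_apply (l : ℕ) (F : Fin n → (Fin n → ℕ) → ℝ) (i : Fin n)
    (N : Fin n → ℕ) :
    (visitOp a ^ (l + 1)) F i N = ∑ j, a i j * (visitOp a ^ l) F j (N + Pi.single i 1) := by
  rw [pow_succ', Module.End.mul_apply, visitOp_apply]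

/-- After `l` steps exactly `l` visits have been recorded, so only those values matter. -/
theorem visitOp_pow_mono (ha : ∀ i j, 0 ≤ a i j) (l : ℕ) {F G : Fin n → (Fin n → ℕ) → ℝ}
    (i : Fin n) (M : Fin n → ℕ)
    (h : ∀ j N, ∑ k, N k = l → F j (M + N) ≤ G j (M + N)) :
    (visitOp a ^ l) F i M ≤ (visitOp a ^ l) G i M := by
  induction l generalizing i M with
  | zero => simpa using h i 0 (by simp)
  | succ l ih =>
    simp only [visitOp_pow_succ_apply]
    refine Finset.sum_le_sum fun j _ => mul_le_mul_of_nonneg_left (ih _ _ ?_) (ha i j)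
    intro k N hN
    rw [add_assoc]
    exact h k _ (by simp [Finset.sum_add_distrib, hN, add_comm])

theorem visitOp_pow_translate (l : ℕ) (F : Fin n → (Fin n → ℕ) → ℝ) (i : Fin n)
    (K M : Fin n → ℕ) :
    (visitOp a ^ l) (fun j N => F j (N + M)) i K = (visitOp a ^ l) F i (K + M) := by
  induction l generalizing i K with
  | zero => rfl
  | succ l ih => simp only [visitOp_pow_succ_apply, ih, add_right_comm]

theorem visitOp_pow_const (ha1 : ∀ i, ∑ j, a i j = 1) (l : ℕ) (c : ℝ) :
    (visitOp a ^ l) (fun _ _ => c) = fun _ _ => c := by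
  induction l with
  | zero => rfl
  | succ l ih =>
    funext i N
    rw [visitOp_pow_succ_apply, ih, ← Finset.sum_mul, ha1, one_mul]

theorem visitOp_pow_exp (θ g : Fin n → ℝ) (l : ℕ) (i : Fin n) (M : Fin n → ℕ) :
    (visitOp a ^ l) (fun j N => g j * Real.exp (∑ k, θ k * N k)) i M =
      Real.exp (∑ k, θ k * M k) *
        ((Matrix.of fun i j => Real.exp (θ i) * a i j) ^ l).mulVec g i := by
  induction l generalizing i M with
  | zero => simp [mul_comm]
  | succ l ih =>
    rw [visitOp_pow_succ_apply, pow_succ', ← Matrix.mulVec_mulVec]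
    simp only [ih]
    have h : ∑ k, θ k * ((M + Pi.single i 1 : Fin n → ℕ) k : ℝ) = ∑ k, θ k * M k + θ i := by
      simp [mul_add, Finset.sum_add_distrib, Pi.single_apply]
    rw [h, Real.exp_add]
    rw [Matrix.mulVec, dotProduct, Finset.mul_sum]
    exact Finset.sum_congr rfl fun j _ => by simp only [Matrix.of_apply]; ring

/-- Sums over paths are computed by the transition operator. -/
theorem sum_path_eq (m : ℕ) (h : Fin n → ℝ) (Φ : (Fin n → ℕ) → ℝ) (M : Fin n → ℕ) :
    ∑ x : Fin (m + 1) → Fin n, pathPA h a x * Φ (M + ∑ t, Pi.single (x t) 1) =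
      ∑ i, h i * (visitOp a ^ m) (fun j N => Φ (N + Pi.single j 1)) i M := by
  induction m generalizing h M with
  | zero =>
    rw [← (Equiv.funUnique (Fin 1) (Fin n)).symm.sum_comp]
    simp [pathPA]
  | succ m ih =>
    rw [← (Fin.consEquiv fun _ => Fin n).sum_comp, Fintype.sum_prod_type]
    refine Finset.sum_congr rfl fun i _ => ?_
    rw [visitOp_pow_succ_apply, ← ih, Finset.mul_sum]
    refine Finset.sum_congr rfl fun y _ => ?_
    simp only [Fin.consEquiv_apply, pathPA, Fin.cons_zero, Fin.prod_univ_succ,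
      Fin.sum_univ_succ (n := m + 1), Fin.cons_succ, Fin.castSucc_zero, ← Fin.succ_castSucc]
    rw [add_assoc]
    ring

theorem emp1_eq {m : ℕ} (x : Fin (m + 1) → Fin n) :
    emp1 x = fun i => (((∑ t, Pi.single (x t) 1 : Fin n → ℕ) i : ℕ) : ℝ) / (m + 1) := by
  funext i
  simp [emp1, Finset.sum_apply, Pi.single_apply, eq_comm]

open scoped Classical in
theorem prEventA_eq (π : Fin n → ℝ) (m : ℕ) (Γ : Set (Fin n → ℝ)) :
    prEventA π a m Γ = ∑ i, π i * (visitOp a ^ m) (fun j N =>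
      if (fun k => (((N + Pi.single j 1 : Fin n → ℕ) k : ℕ) : ℝ) / (m + 1)) ∈ Γ
        then 1 else 0) i 0 := by
  have := sum_path_eq (a := a) m π
    (fun N => if (fun k => ((N k : ℕ) : ℝ) / (m + 1)) ∈ Γ then (1 : ℝ) else 0) 0
  rw [← this, prEventA]
  refine Finset.sum_congr rfl fun x _ => ?_
  rw [emp1_eq, zero_add]
  simp

end VisitOp

section Superharmonic

variable {n : ℕ}

theorem Matrix.pow_apply_pos_of_support {A D : Matrix (Fin n) (Fin n) ℝ}
    (hA : ∀ i j, 0 ≤ A i j) (hD : ∀ i j, 0 ≤ D i j) (h : ∀ i j, 0 < A i j → 0 < D i j) (l : ℕ)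
    (i j : Fin n) (hl : 0 < (A ^ l) i j) : 0 < (D ^ l) i j := by
  induction l generalizing j with
  | zero => simpa using hl
  | succ l ih =>
    rw [pow_succ, Matrix.mul_apply] at hl ⊢
    obtain ⟨k, -, hk⟩ := Finset.exists_lt_of_sum_lt (f := fun _ => (0 : ℝ)) (by simpa using hl)
    have h1 := Matrix.pow_apply_nonneg hA l i k
    have h2 : 0 < (A ^ l) i k := h1.lt_of_ne' (left_ne_zero_of_mul hk.ne')
    have h3 : 0 < A k j := (hA k j).lt_of_ne' (right_ne_zero_of_mul hk.ne')
    exact Finset.sum_pos'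
      (fun m _ => mul_nonneg (Matrix.pow_apply_nonneg hD l i m) (hD m j))
      ⟨k, Finset.mem_univ k, mul_pos (ih k h2) (h k j h3)⟩

/-- An irreducible nonnegative matrix whose Green function at `s` is finite has a positive
superharmonic vector. -/
theorem exists_superharmonic {D : Matrix (Fin n) (Fin n) ℝ} (hD : ∀ i j, 0 ≤ D i j)
    (hirr : ∀ i j, ∃ k : ℕ, 0 < (D ^ k) i j) (s : Fin n)
    (hs : Summable fun l : ℕ => (D ^ l) s s) :
    ∃ u : Fin n → ℝ, (∀ i, 0 < u i) ∧ ∀ i, ∑ j, D i j * u j ≤ u i := by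
  have hsum : ∀ i, Summable fun l : ℕ => (D ^ l) i s := by
    intro i
    obtain ⟨k, hk⟩ := hirr s i
    have h1 : Summable fun l : ℕ => (D ^ (k + l)) s s := by
      simpa only [add_comm k] using (summable_nat_add_iff k).2 hs
    have h2 : Summable fun l : ℕ => (D ^ k) s i * (D ^ l) i s := by
      refine Summable.of_nonneg_of_le
        (fun l => mul_nonneg hk.le (Matrix.pow_apply_nonneg hD l i s)) (fun l => ?_) h1
      rw [pow_add, Matrix.mul_apply]
      exact Finset.single_le_sum (f := fun m => (D ^ k) s m * (D ^ l) m s)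
        (fun m _ => mul_nonneg (Matrix.pow_apply_nonneg hD k s m)
          (Matrix.pow_apply_nonneg hD l m s)) (Finset.mem_univ i)
    exact (summable_mul_left_iff hk.ne').1 h2
  refine ⟨fun i => ∑' l : ℕ, (D ^ l) i s, fun i => ?_, fun i => ?_⟩
  · obtain ⟨k, hk⟩ := hirr i s
    exact (hsum i).tsum_pos (fun l => Matrix.pow_apply_nonneg hD l i s) k hk
  · have h1 : ∑ j, D i j * ∑' l : ℕ, (D ^ l) j s = ∑' l : ℕ, (D ^ (l + 1)) i s := by
      simp only [← tsum_mul_left]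
      rw [← Summable.tsum_finsetSum fun j _ => (hsum j).mul_left _]
      exact tsum_congr fun l => by rw [pow_succ', Matrix.mul_apply]
    refine h1.trans_le ?_
    refine le_of_le_of_eq ?_ (hsum i).tsum_eq_zero_add.symm
    exact le_add_of_nonneg_left (Matrix.pow_apply_nonneg hD 0 i s)

end Superharmonic

section Loops

variable {n : ℕ}

/-- The indicator function of the state `s` with visit counts `N`. -/
def pointFn (s : Fin n) (N : Fin n → ℕ) : Fin n → (Fin n → ℕ) → ℝ :=
  fun j K => if j = s ∧ K = N then 1 else 0

/-- Total weight of the loops of length `l` at `s` with visit counts `N`. -/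
def loopWeight (a : Fin n → Fin n → ℝ) (s : Fin n) (l : ℕ) (N : Fin n → ℕ) : ℝ :=
  (visitOp a ^ l) (pointFn s N) s 0

variable {a : Fin n → Fin n → ℝ}

theorem pointFn_nonneg (s : Fin n) (N : Fin n → ℕ) (j : Fin n) (K : Fin n → ℕ) :
    0 ≤ pointFn s N j K := by
  unfold pointFn; split_ifs <;> norm_num

theorem visitOp_pow_nonneg (ha : ∀ i j, 0 ≤ a i j) (l : ℕ) {F : Fin n → (Fin n → ℕ) → ℝ}
    (hF : ∀ j N, 0 ≤ F j N) (i : Fin n) (M : Fin n → ℕ) : 0 ≤ (visitOp a ^ l) F i M := by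
  have := visitOp_pow_mono ha l (F := 0) (G := F) i M fun j N _ => hF j _
  simpa using this

theorem pointFn_translate (s : Fin n) (N N' : Fin n → ℕ) :
    (fun j K => pointFn s (N' + N) j (K + N)) = pointFn s N' := by
  funext j K
  simp [pointFn]

theorem visitOp_pow_pointFn (s : Fin n) (l : ℕ) (N N' : Fin n → ℕ) :
    (visitOp a ^ l) (pointFn s (N' + N)) s N = loopWeight a s l N' := by
  rw [loopWeight, ← pointFn_translate s N N', visitOp_pow_translate, zero_add]

/-- The Markov property at the state `s` with visit counts `N`. -/
theorem loopWeight_mul_le (ha : ∀ i j, 0 ≤ a i j) (s : Fin n) (l l' : ℕ) (N : Fin n → ℕ)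
    {F : Fin n → (Fin n → ℕ) → ℝ} (hF : ∀ j N, 0 ≤ F j N) :
    loopWeight a s l N * (visitOp a ^ l') F s N ≤ (visitOp a ^ (l + l')) F s 0 := by
  rw [pow_add, Module.End.mul_apply]
  have h : (visitOp a ^ l) ((visitOp a ^ l') F s N • pointFn s N) s 0 ≤
      (visitOp a ^ l) ((visitOp a ^ l') F) s 0 := by
    refine visitOp_pow_mono ha l s 0 fun j K _ => ?_
    simp only [Pi.smul_apply, smul_eq_mul, pointFn]
    split_ifs with hjk
    · rw [hjk.1, hjk.2, mul_one]
    · rw [mul_zero]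
      exact visitOp_pow_nonneg ha l' hF _ _
  rwa [map_smul, Pi.smul_apply, Pi.smul_apply, smul_eq_mul, mul_comm] at h

theorem loopWeight_mul_loopWeight_le (ha : ∀ i j, 0 ≤ a i j) (s : Fin n) (l l' : ℕ)
    (N N' : Fin n → ℕ) :
    loopWeight a s l N * loopWeight a s l' N' ≤ loopWeight a s (l + l') (N + N') := by
  have := loopWeight_mul_le ha s l l' N (F := pointFn s (N' + N)) (pointFn_nonneg s _)
  rwa [visitOp_pow_pointFn, add_comm N' N] at this

theorem loopWeight_le_one (ha : ∀ i j, 0 ≤ a i j) (ha1 : ∀ i, ∑ j, a i j = 1) (s : Fin n)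
    (l : ℕ) (N : Fin n → ℕ) : loopWeight a s l N ≤ 1 := by
  have := visitOp_pow_mono ha l (F := pointFn s N) (G := fun _ _ => 1) s 0 fun j K _ => by
    unfold pointFn; split_ifs <;> norm_num
  rwa [visitOp_pow_const ha1] at this

theorem sum_eq_of_loopWeight_pos (ha : ∀ i j, 0 ≤ a i j) {s : Fin n} {l : ℕ} {N : Fin n → ℕ}
    (h : 0 < loopWeight a s l N) : ∑ k, N k = l := by
  by_contra hne
  have := visitOp_pow_mono ha l (F := pointFn s N) (G := 0) s 0 fun j K hK => by
    have : K ≠ N := by rintro rfl; exact hne hK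
    simp [pointFn, this]
  rw [map_zero] at this
  exact absurd h (not_lt.2 this)

theorem loopWeight_zero (s : Fin n) : loopWeight a s 0 0 = 1 := by
  simp [loopWeight, pointFn]

/-- Polynomial growth of the tilted return weights when every class of loops has tilted
weight at most one. -/
theorem tilted_pow_le (ha : ∀ i j, 0 ≤ a i j) (s : Fin n) (θ : Fin n → ℝ)
    (h : ∀ l N, Real.exp (∑ k, θ k * N k) * loopWeight a s l N ≤ 1) (l : ℕ) :
    ((Matrix.of fun i j => Real.exp (θ i) * a i j) ^ l) s s ≤ ((l : ℝ) + 1) ^ n := by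
  have h1 := visitOp_pow_exp (a := a) θ (Pi.single s 1) l s 0
  simp only [Pi.zero_apply, Nat.cast_zero, mul_zero, Finset.sum_const_zero, Real.exp_zero,
    one_mul, Matrix.mulVec_single_one, Matrix.col_apply] at h1
  rw [← h1]
  set grid : Finset (Fin n → ℕ) := Fintype.piFinset fun _ => Finset.range (l + 1) with hgrid
  have h2 := visitOp_pow_mono ha l
    (F := fun j N => (Pi.single s 1 : Fin n → ℝ) j * Real.exp (∑ k, θ k * N k))
    (G := ∑ K ∈ grid, Real.exp (∑ k, θ k * K k) • pointFn s K) s 0 fun j N hN => by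
      rw [zero_add, Finset.sum_apply, Finset.sum_apply]
      have hmem : N ∈ grid := by
        rw [hgrid, Fintype.mem_piFinset]
        intro k
        rw [Finset.mem_range, ← hN]
        exact Nat.lt_succ_of_le (Finset.single_le_sum (fun _ _ => Nat.zero_le _)
          (Finset.mem_univ k))
      refine le_trans (le_of_eq ?_) (Finset.single_le_sum
        (f := fun K : Fin n → ℕ => (Real.exp (∑ k, θ k * (K k : ℝ)) • pointFn s K) j N)
        (fun K _ => ?_) hmem)
      · simp [pointFn, Pi.single_apply]
      · exact mul_nonneg (Real.exp_pos _).le (pointFn_nonneg _ _ _ _)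
  refine h2.trans ?_
  simp only [map_sum, map_smul, Finset.sum_apply, Pi.smul_apply, smul_eq_mul]
  refine (Finset.sum_le_card_nsmul _ _ 1 fun K _ => h l K).trans ?_
  simp [hgrid]

end Loops

section Separation

/-- A point outside the closed cone generated by an additive submonoid is separated from it
by a linear functional. -/
theorem exists_separating_of_addSubmonoid {E : Type*} [NormedAddCommGroup E] [NormedSpace ℝ E]
    (S : AddSubmonoid E) {x : E}
    (hx : x ∉ closure {p : E | ∃ L : ℕ, ∃ q ∈ S, p = ((L : ℝ) + 1)⁻¹ • q}) :
    ∃ f : StrongDual ℝ E, (∀ q ∈ S, f q ≤ 0) ∧ 0 < f x := by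
  set T₀ : Set E := {p : E | ∃ L : ℕ, ∃ q ∈ S, p = ((L : ℝ) + 1)⁻¹ • q} with hT₀
  have hadd : ∀ p ∈ T₀, ∀ q ∈ T₀, p + q ∈ T₀ := by
    rintro _ ⟨L, p, hp, rfl⟩ _ ⟨L', q, hq, rfl⟩
    refine ⟨L * L' + L + L', (L' + 1) • p + (L + 1) • q,
      S.add_mem (S.nsmul_mem hp _) (S.nsmul_mem hq _), ?_⟩
    rw [← Nat.cast_smul_eq_nsmul ℝ, ← Nat.cast_smul_eq_nsmul ℝ, smul_add, smul_smul, smul_smul]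
    have h1 : (L : ℝ) + 1 ≠ 0 := by positivity
    have h2 : (L' : ℝ) + 1 ≠ 0 := by positivity
    have h3 : ((L * L' + L + L' : ℕ) : ℝ) + 1 = (L + 1) * (L' + 1) := by push_cast; ring
    rw [h3]
    congr 2 <;> push_cast <;> field_simp
  have hsmul : ∀ t : ℝ, 0 ≤ t → ∀ p ∈ T₀, t • p ∈ closure T₀ := by
    rintro t ht _ ⟨L, p, hp, rfl⟩
    have hlim : Filter.Tendsto (fun k : ℕ => (⌊t * ((k : ℝ) + 1)⌋₊ : ℝ) / ((k : ℝ) + 1))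
        Filter.atTop (nhds t) :=
      (tendsto_nat_floor_mul_div_atTop ht).comp
        (Filter.tendsto_atTop_add_const_right _ _ tendsto_natCast_atTop_atTop)
    refine mem_closure_of_tendsto (hlim.smul_const (((L : ℝ) + 1)⁻¹ • p))
      (Filter.Eventually.of_forall fun k => ?_)
    refine ⟨L * k + L + k, ⌊t * ((k : ℝ) + 1)⌋₊ • p, S.nsmul_mem hp _, ?_⟩
    rw [← Nat.cast_smul_eq_nsmul ℝ, smul_smul, smul_smul]
    congr 1
    push_cast
    have h1 : (L : ℝ) + 1 ≠ 0 := by positivity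
    have h2 : (k : ℝ) + 1 ≠ 0 := by positivity
    have h3 : (L * k + L + k : ℝ) + 1 = (L + 1) * (k + 1) := by ring
    rw [h3]
    field_simp
  have hconv : Convex ℝ (closure T₀) := by
    have hadd' : ∀ p ∈ closure T₀, ∀ q ∈ closure T₀, p + q ∈ closure T₀ := fun p hp q hq =>
      map_mem_closure₂ continuous_add hp hq hadd
    have hsmul' : ∀ t : ℝ, 0 ≤ t → ∀ p ∈ closure T₀, t • p ∈ closure T₀ := fun t ht p hp => by
      have := map_mem_closure (continuous_const_smul t) hp (hsmul t ht)
      rwa [closure_closure] at this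
    intro p hp q hq s t hs ht _
    exact hadd' _ (hsmul' s hs p hp) _ (hsmul' t ht q hq)
  obtain ⟨f, b, hf, hb⟩ := geometric_hahn_banach_closed_point hconv isClosed_closure hx
  have hS : ∀ q ∈ S, f q < b := fun q hq => hf q (subset_closure ⟨0, q, hq, by simp⟩)
  have hb0 : 0 < b := by simpa using hS 0 S.zero_mem
  refine ⟨f, fun q hq => ?_, hb0.trans hb⟩
  by_contra! hpos
  obtain ⟨k, hk⟩ := exists_nat_gt (b / f q)
  have := hS (k • q) (S.nsmul_mem hq k)
  rw [map_nsmul, nsmul_eq_mul] at this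
  rw [div_lt_iff₀ hpos] at hk
  linarith

variable {n : ℕ} {a : Fin n → Fin n → ℝ}

/-- The pairs `(N, r)` such that the loops at `s` with visit counts `N` have weight at least
`exp (-r)`. -/
def loopSubmonoid (ha : ∀ i j, 0 ≤ a i j) (s : Fin n) : AddSubmonoid ((Fin n → ℝ) × ℝ) where
  carrier := {p | ∃ (l : ℕ) (N : Fin n → ℕ), p.1 = (fun k => (N k : ℝ)) ∧
    Real.exp (-p.2) ≤ loopWeight a s l N}
  zero_mem' := ⟨0, 0, by ext; simp, by simp [loopWeight_zero]⟩
  add_mem' := by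
    rintro ⟨p, r⟩ ⟨p', r'⟩ ⟨l, N, hp, hr⟩ ⟨l', N', hp', hr'⟩
    refine ⟨l + l', N + N', ?_, ?_⟩
    · simp only at hp hp' ⊢
      funext k
      simp [hp, hp']
    · refine le_trans ?_ (loopWeight_mul_loopWeight_le ha s l l' N N')
      have h : Real.exp (-((p, r) + (p', r')).2) = Real.exp (-r) * Real.exp (-r') := by
        rw [← Real.exp_add]; congr 1; simp only [Prod.mk_add_mk]; ring
      rw [h]
      exact mul_le_mul hr hr' (Real.exp_pos _).le ((Real.exp_pos _).le.trans hr)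

theorem nonneg_of_mem_loopSubmonoid (ha : ∀ i j, 0 ≤ a i j) (ha1 : ∀ i, ∑ j, a i j = 1)
    {s : Fin n} {p : (Fin n → ℝ) × ℝ} (hp : p ∈ loopSubmonoid ha s) : 0 ≤ p.2 := by
  obtain ⟨l, N, -, h⟩ := hp
  have := h.trans (loopWeight_le_one ha ha1 s l N)
  rw [Real.exp_le_one_iff] at this
  linarith

/-- If every class of loops has tilted weight at most one, then the tilt is dominated by the
rate function. -/
theorem le_rateCol_of_tilted (ha : ∀ i j, 0 ≤ a i j) (hrow : ∀ i, ∃ j, 0 < a i j)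
    (hirr : ∀ i j, ∃ k : ℕ, 0 < ((Matrix.of a) ^ k) i j) (s : Fin n) (θ : Fin n → ℝ)
    (h : ∀ l N, Real.exp (∑ k, θ k * N k) * loopWeight a s l N ≤ 1) {φ : Fin n → ℝ}
    (hφ : φ ∈ simplex n) : ((∑ k, θ k * φ k : ℝ) : EReal) ≤ rateCol a φ := by
  refine ereal_le_of_forall_exists_add (c := 1) fun ε hε => ?_
  set B : Matrix (Fin n) (Fin n) ℝ := Matrix.of fun i j => Real.exp (θ i) * a i j with hB
  set D : Matrix (Fin n) (Fin n) ℝ := Real.exp (-ε) • B with hD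
  have hDapp : ∀ i j, D i j = Real.exp (-ε) * (Real.exp (θ i) * a i j) := fun i j => rfl
  have hD0 : ∀ i j, 0 ≤ D i j := fun i j => by
    rw [hDapp]
    exact mul_nonneg (Real.exp_pos _).le (mul_nonneg (Real.exp_pos _).le (ha i j))
  have hDpos : ∀ i j, 0 < a i j → 0 < D i j := fun i j hij => by
    rw [hDapp]
    positivity
  have hDirr : ∀ i j, ∃ k : ℕ, 0 < (D ^ k) i j := fun i j => by
    obtain ⟨k, hk⟩ := hirr i j
    exact ⟨k, Matrix.pow_apply_pos_of_support (fun i j => ha i j) hD0 hDpos k i j hk⟩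
  have hsum : Summable fun l : ℕ => (D ^ l) s s := by
    have hlt : ‖Real.exp (-ε)‖ < 1 := by
      rw [Real.norm_eq_abs, abs_of_pos (Real.exp_pos _), Real.exp_lt_one_iff]; linarith
    have h1 := summable_pow_mul_geometric_of_norm_lt_one n hlt
    have h2 := ((summable_nat_add_iff 1).2 h1).mul_left (Real.exp (-ε))⁻¹
    refine Summable.of_nonneg_of_le (fun l => Matrix.pow_apply_nonneg hD0 l s s)
      (fun l => ?_) h2
    have h3 := tilted_pow_le ha s θ h l
    rw [hD, smul_pow, Matrix.smul_apply, smul_eq_mul]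
    calc _ ≤ Real.exp (-ε) ^ l * ((l : ℝ) + 1) ^ n :=
          mul_le_mul_of_nonneg_left h3 (by positivity)
      _ = _ := by
          push_cast
          rw [pow_succ]
          field_simp
  obtain ⟨u, hu, hDu⟩ := exists_superharmonic hD0 hDirr s hsum
  refine ⟨_, le_iSup₂_of_le u hu le_rfl, ?_⟩
  have hau : ∀ i, 0 < ∑ j, a i j * u j := fun i => by
    obtain ⟨j, hj⟩ := hrow i
    exact Finset.sum_pos' (fun k _ => mul_nonneg (ha i k) (hu k).le)
      ⟨j, Finset.mem_univ j, mul_pos hj (hu j)⟩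
  have hterm : ∀ i, θ i - ε ≤ Real.log (u i / ∑ j, a i j * u j) := fun i => by
    rw [Real.le_log_iff_exp_le (div_pos (hu i) (hau i)), le_div_iff₀ (hau i)]
    refine le_trans (le_of_eq ?_) (hDu i)
    rw [sub_eq_add_neg, Real.exp_add, Finset.mul_sum]
    exact Finset.sum_congr rfl fun j _ => by rw [hDapp]; ring
  have h1 : ∑ i, φ i * (θ i - ε) ≤ ∑ i, φ i * Real.log (u i / ∑ j, a i j * u j) :=
    Finset.sum_le_sum fun i _ => mul_le_mul_of_nonneg_left (hterm i) (hφ.1 i)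
  have h2 : ∑ i, φ i * (θ i - ε) = ∑ k, θ k * φ k - ε := by
    simp only [mul_sub, Finset.sum_sub_distrib, ← Finset.sum_mul, hφ.2, one_mul]
    simp only [mul_comm]
  linarith

/-- Above the graph of the rate function, points are limits of normalised loop data. -/
theorem mem_closure_loops (ha : ∀ i j, 0 ≤ a i j) (ha1 : ∀ i, ∑ j, a i j = 1)
    (hirr : ∀ i j, ∃ k : ℕ, 0 < ((Matrix.of a) ^ k) i j) (s : Fin n) {φ : Fin n → ℝ}
    (hφ : φ ∈ simplex n) {c : ℝ} (hc : rateCol a φ < c) :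
    (φ, c) ∈ closure {p : (Fin n → ℝ) × ℝ |
      ∃ L : ℕ, ∃ q ∈ loopSubmonoid ha s, p = ((L : ℝ) + 1)⁻¹ • q} := by
  by_contra hx
  obtain ⟨f, hf, hfx⟩ := exists_separating_of_addSubmonoid _ hx
  have hrow : ∀ i, ∃ j, 0 < a i j := fun i => by
    obtain ⟨j, -, hj⟩ := Finset.exists_lt_of_sum_lt (s := Finset.univ) (f := fun _ => (0 : ℝ))
      (g := a i) (by simp [ha1 i])
    exact ⟨j, hj⟩
  set g : Fin n → ℝ := fun k => f (Pi.single k 1, 0) with hg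
  set κ : ℝ := f (0, 1) with hκ
  have hfeq : ∀ p r, f (p, r) = ∑ k, g k * p k + κ * r := by
    intro p r
    have h1 : ((p, r) : (Fin n → ℝ) × ℝ) =
        ∑ k, p k • ((Pi.single k 1, 0) : (Fin n → ℝ) × ℝ) + r • (0, 1) := by
      ext k
      · simp [Prod.fst_sum, Finset.sum_apply, Pi.single_apply]
      · simp [Prod.snd_sum]
    rw [h1, map_add, map_sum, map_smul]
    simp only [map_smul, smul_eq_mul, hg, hκ, mul_comm]
  have hκ0 : κ ≤ 0 := hf (0, 1) ⟨0, 0, by ext; simp, by simp [loopWeight_zero]⟩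
  rw [hfeq] at hfx
  obtain ⟨δ, hδ, hδc⟩ : ∃ δ > 0, δ * c < ∑ k, g k * φ k + κ * c := by
    refine ⟨(∑ k, g k * φ k + κ * c) / (|c| + 1), div_pos hfx (by positivity), ?_⟩
    rw [div_mul_eq_mul_div, div_lt_iff₀ (by positivity)]
    nlinarith [le_abs_self c]
  set τ : ℝ := δ - κ with hτ
  have hτ0 : 0 < τ := by rw [hτ]; linarith
  have htilt : ∀ l N, Real.exp (∑ k, (g k / τ) * (N k : ℝ)) * loopWeight a s l N ≤ 1 := by
    intro l N
    rcases lt_or_ge 0 (loopWeight a s l N) with hw | hw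
    · have hmem : ((fun k => (N k : ℝ)), -Real.log (loopWeight a s l N)) ∈
          loopSubmonoid ha s := ⟨l, N, rfl, by simp [Real.exp_log hw]⟩
      have h1 := hf _ hmem
      have h2 := nonneg_of_mem_loopSubmonoid ha ha1 hmem
      rw [hfeq] at h1
      simp only at h2
      rw [← Real.exp_log hw, ← Real.exp_add, Real.exp_le_one_iff]
      have h3 : ∑ k, (g k / τ) * (N k : ℝ) = (∑ k, g k * (N k : ℝ)) / τ := by
        rw [Finset.sum_div]; exact Finset.sum_congr rfl fun k _ => by ring
      have h4 : (∑ k, g k * (N k : ℝ)) / τ ≤ -Real.log (loopWeight a s l N) := by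
        rw [div_le_iff₀ hτ0, hτ]
        nlinarith [mul_nonneg hδ.le h2]
      rw [h3]; linarith
    · exact (mul_nonpos_of_nonneg_of_nonpos (Real.exp_pos _).le hw).trans zero_le_one
  have h1 := (le_rateCol_of_tilted ha hrow hirr s (fun k => g k / τ) htilt hφ).trans_lt hc
  have h2 : ∑ k, (g k / τ) * φ k < c := by exact_mod_cast h1
  have h3 : ∑ k, (g k / τ) * φ k = (∑ k, g k * φ k) / τ := by
    rw [Finset.sum_div]; exact Finset.sum_congr rfl fun k _ => by ring
  rw [h3, div_lt_iff₀ hτ0, hτ] at h2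
  linarith

end Separation

section LowerBound

variable {n : ℕ} {a : Fin n → Fin n → ℝ}

theorem le_mul_elog {t p q : ℝ} (ht : 0 ≤ t) (hq : 0 < q) (hqp : q ≤ p) :
    ((t * Real.log q : ℝ) : EReal) ≤ (t : EReal) * elog p := by
  rw [elog, if_neg (not_le.2 (hq.trans_le hqp)), ← EReal.coe_mul, EReal.coe_le_coe_iff]
  exact mul_le_mul_of_nonneg_left (Real.log_le_log hq hqp) ht

theorem mul_elog_le {t p q : ℝ} (ht : 0 < t) (hqp : p ≤ q) :
    (t : EReal) * elog p ≤ ((t * Real.log q : ℝ) : EReal) := by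
  unfold elog
  split_ifs with hp
  · rw [EReal.coe_mul_bot_of_pos ht]
    exact bot_le
  · rw [← EReal.coe_mul, EReal.coe_le_coe_iff]
    exact mul_le_mul_of_nonneg_left (Real.log_le_log (not_le.1 hp) hqp) ht.le

theorem dist1v_triangle (p q r : Fin n → ℝ) : dist1v p r ≤ dist1v p q + dist1v q r := by
  unfold dist1v
  rw [← Finset.sum_add_distrib]
  exact Finset.sum_le_sum fun i _ => abs_sub_le _ _ _

theorem loopWeight_pow_le (ha : ∀ i j, 0 ≤ a i j) (s : Fin n) (l : ℕ) (N : Fin n → ℕ) (q : ℕ) :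
    loopWeight a s l N ^ q ≤ loopWeight a s (q * l) (q • N) := by
  induction q with
  | zero => simp [loopWeight_zero]
  | succ q ih =>
    rw [pow_succ, Nat.succ_mul, succ_nsmul]
    refine le_trans (mul_le_mul_of_nonneg_right ih ?_)
      (loopWeight_mul_loopWeight_le ha s _ _ _ _)
    exact visitOp_pow_nonneg ha l (pointFn_nonneg s N) s 0

/-- Visit counts made of `m / l` copies of `N` followed by fewer than `l` further steps have
frequencies close to those of `N`. -/
theorem dist1v_frequencies_le {l m : ℕ} (hl : 0 < l) {N K : Fin n → ℕ} (hN : ∑ k, N k = l)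
    (hK : ∑ k, K k = m % l + 1) :
    dist1v (fun k => ((((m / l) • N + K) k : ℕ) : ℝ) / (m + 1)) (fun k => (N k : ℝ) / l) ≤
      2 * l / (m + 1) := by
  have hl' : (0 : ℝ) < l := by exact_mod_cast hl
  have hm' : (0 : ℝ) < (m : ℝ) + 1 := by positivity
  have hdiv : (l : ℝ) * (m / l : ℕ) + (m % l : ℕ) = m := by exact_mod_cast Nat.div_add_mod m l
  have hN' : ∑ k, (N k : ℝ) = l := by exact_mod_cast hN
  have hK' : ∑ k, (K k : ℝ) = (m % l : ℕ) + 1 := by exact_mod_cast hK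
  have hlt : ((m % l : ℕ) : ℝ) + 1 ≤ l := by exact_mod_cast Nat.mod_lt m hl
  set ρ : ℝ := ((m % l : ℕ) : ℝ) + 1 with hρ
  have hρ0 : 0 ≤ ρ := by positivity
  have hterm : ∀ k, |((((m / l) • N + K) k : ℕ) : ℝ) / (m + 1) - (N k : ℝ) / l| ≤
      ((K k : ℝ) + ρ / l * N k) / (m + 1) := by
    intro k
    have h1 : ((((m / l) • N + K) k : ℕ) : ℝ) / (m + 1) - (N k : ℝ) / l =
        ((K k : ℝ) - ρ / l * N k) / (m + 1) := by
      simp only [Pi.add_apply, Pi.smul_apply, smul_eq_mul]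
      push_cast
      field_simp
      rw [hρ, ← hdiv]
      ring
    rw [h1, abs_div, abs_of_pos hm']
    gcongr
    refine (abs_sub _ _).trans (le_of_eq ?_)
    rw [abs_of_nonneg (by positivity), abs_of_nonneg (by positivity)]
  unfold dist1v
  refine (Finset.sum_le_sum fun k _ => hterm k).trans ?_
  rw [← Finset.sum_div, Finset.sum_add_distrib, ← Finset.mul_sum, hN', hK',
    div_mul_cancel₀ _ hl'.ne']
  gcongr
  linarith

theorem le_prEventA {π : Fin n → ℝ} (hπ : ∀ i, 0 ≤ π i) (ha : ∀ i j, 0 ≤ a i j)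
    (ha1 : ∀ i, ∑ j, a i j = 1) {s : Fin n} {l : ℕ} (hl : 0 < l) {N : Fin n → ℕ}
    (hN : ∑ k, N k = l) {δ : ℝ} {Γ : Set (Fin n → ℝ)}
    (hΓ : ∀ ξ ∈ simplex n, dist1v ξ (fun k => (N k : ℝ) / l) < δ → ξ ∈ Γ) {m : ℕ}
    (hm : 2 * (l : ℝ) / (m + 1) < δ) :
    π s * loopWeight a s l N ^ (m / l) ≤ prEventA π a m Γ := by
  classical
  rw [prEventA_eq]
  set F : Fin n → (Fin n → ℕ) → ℝ := fun j N =>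
    if (fun k => (((N + Pi.single j 1 : Fin n → ℕ) k : ℕ) : ℝ) / (m + 1)) ∈ Γ
      then 1 else 0 with hF
  have hF0 : ∀ j N, 0 ≤ F j N := fun j N => by rw [hF]; dsimp only; split_ifs <;> norm_num
  refine le_trans ?_ (Finset.single_le_sum
    (f := fun i => π i * (visitOp a ^ m) F i 0)
    (fun i _ => mul_nonneg (hπ i) (visitOp_pow_nonneg ha m hF0 i 0)) (Finset.mem_univ s))
  refine mul_le_mul_of_nonneg_left ?_ (hπ s)
  have hend : 1 ≤ (visitOp a ^ (m % l)) F s ((m / l) • N) := by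
    have := visitOp_pow_mono ha (m % l) (F := fun _ _ => 1) (G := F) s ((m / l) • N)
      fun j K hK => by
        rw [hF]
        dsimp only
        have hK' : ∑ k, (K + Pi.single j 1 : Fin n → ℕ) k = m % l + 1 := by
          simp [Finset.sum_add_distrib, hK]
        rw [if_pos]
        rw [add_assoc]
        refine hΓ _ ⟨fun k => by positivity, ?_⟩
          ((dist1v_frequencies_le hl hN hK').trans_lt hm)
        rw [← Finset.sum_div, div_eq_one_iff_eq (by positivity), ← Nat.cast_sum]
        have : ∑ k, ((m / l) • N + (K + Pi.single j 1) : Fin n → ℕ) k = m + 1 := by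
          simp only [Pi.add_apply ((m / l) • N), Pi.smul_apply, smul_eq_mul,
            Finset.sum_add_distrib (f := fun k => m / l * N k), hK', ← Finset.mul_sum, hN]
          rw [← add_assoc, mul_comm, Nat.div_add_mod]
        exact_mod_cast this
    rwa [visitOp_pow_const ha1] at this
  have h1 := loopWeight_mul_le ha s (m / l * l) (m % l) ((m / l) • N) hF0
  rw [mul_comm (m / l) l, Nat.div_add_mod] at h1
  have h2 := loopWeight_pow_le ha s l N (m / l)
  rw [mul_comm (m / l) l] at h2
  have h3 : 0 ≤ loopWeight a s (l * (m / l)) ((m / l) • N) :=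
    visitOp_pow_nonneg ha _ (pointFn_nonneg s _) s 0
  calc _ ≤ _ := h2
    _ ≤ _ := le_mul_of_one_le_right h3 hend
    _ ≤ _ := h1

theorem ldp_lower_at {π : Fin n → ℝ} (hπ : ∀ i, 0 ≤ π i) (ha : ∀ i j, 0 ≤ a i j)
    (ha1 : ∀ i, ∑ j, a i j = 1)
    (hirr : ∀ i j, ∃ k : ℕ, 0 < ((Matrix.of a) ^ k) i j) {s : Fin n} (hs : 0 < π s)
    {Γ : Set (Fin n → ℝ)} (hΓ : OpenInV (simplex n) Γ) {φ : Fin n → ℝ} (hφΓ : φ ∈ Γ)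
    (hφ : φ ∈ simplex n) {c : ℝ} (hc : rateCol a φ < c) :
    ((-c : ℝ) : EReal) ≤ Filter.liminf
      (fun m : ℕ => ((((m : ℝ) + 1)⁻¹ : ℝ) : EReal) * elog (prEventA π a m Γ))
      Filter.atTop := by
  obtain ⟨c₁, hc₁, hc₁c⟩ := EReal.lt_iff_exists_real_btwn.1 hc
  have hc₁c' : c₁ < c := by exact_mod_cast hc₁c
  obtain ⟨ε, hε, hball⟩ := hΓ φ hφΓ
  have hfreq := mem_closure_iff_frequently.1 (mem_closure_loops ha ha1 hirr s hφ hc₁)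
  have hsum : Continuous fun p : (Fin n → ℝ) × ℝ => ∑ k, p.1 k := by fun_prop
  have hne : ∑ k, ((φ, c₁) : (Fin n → ℝ) × ℝ).1 k ≠ 0 := by simp [hφ.2]
  have hev1 : ∀ᶠ p : (Fin n → ℝ) × ℝ in nhds (φ, c₁), 0 < ∑ k, p.1 k :=
    hsum.continuousAt.eventually_const_lt (by simp [hφ.2])
  have hev2 : ∀ᶠ p : (Fin n → ℝ) × ℝ in nhds (φ, c₁), p.2 / ∑ k, p.1 k < c := by
    have : ContinuousAt (fun p : (Fin n → ℝ) × ℝ => p.2 / ∑ k, p.1 k) (φ, c₁) :=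
      continuousAt_snd.div hsum.continuousAt hne
    exact this.eventually_lt_const (by simpa [hφ.2] using hc₁c')
  have hev3 : ∀ᶠ p : (Fin n → ℝ) × ℝ in nhds (φ, c₁),
      dist1v (fun i => p.1 i / ∑ k, p.1 k) φ < ε := by
    have : ContinuousAt (fun p : (Fin n → ℝ) × ℝ =>
        dist1v (fun i => p.1 i / ∑ k, p.1 k) φ) (φ, c₁) := by
      unfold dist1v
      refine tendsto_finsetSum _ fun i _ => ?_
      have h1 : ContinuousAt (fun p : (Fin n → ℝ) × ℝ => p.1 i) (φ, c₁) := by fun_prop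
      exact ((h1.div hsum.continuousAt hne).sub continuousAt_const).abs
    exact this.eventually_lt_const (by simpa [hφ.2, dist1v] using hε)
  obtain ⟨_, ⟨L, ⟨_, r⟩, ⟨l, N, rfl, hw⟩, rfl⟩, hp1, hp2, hp3⟩ :=
    (hfreq.and_eventually (hev1.and (hev2.and hev3))).exists
  have hwpos : 0 < loopWeight a s l N := (Real.exp_pos _).trans_le hw
  have hN : ∑ k, N k = l := sum_eq_of_loopWeight_pos ha hwpos
  have hN' : ∑ k, (N k : ℝ) = l := by exact_mod_cast hN
  have hr : 0 ≤ r := nonneg_of_mem_loopSubmonoid ha ha1 (s := s)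
    (p := ((fun k => (N k : ℝ)), r)) ⟨l, N, rfl, hw⟩
  have hL : (0 : ℝ) < ((L : ℝ) + 1)⁻¹ := by positivity
  simp only [Prod.smul_mk, Pi.smul_apply, smul_eq_mul, ← Finset.mul_sum, hN',
    mul_div_mul_left _ _ hL.ne'] at hp1 hp2 hp3 hw
  have hl' : (0 : ℝ) < l := by
    by_contra! h
    exact absurd hp1 (not_lt.2 (mul_nonpos_of_nonneg_of_nonpos hL.le h))
  have hl : 0 < l := by exact_mod_cast hl'
  have hδ : 0 < ε - dist1v (fun i => (N i : ℝ) / l) φ := by linarith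
  have hΓN : ∀ ξ ∈ simplex n, dist1v ξ (fun k => (N k : ℝ) / l) <
      ε - dist1v (fun i => (N i : ℝ) / l) φ → ξ ∈ Γ := fun ξ hξ h =>
    hball ξ hξ ((dist1v_triangle _ (fun k => (N k : ℝ) / l) _).trans_lt (by linarith))
  have hatTop : Filter.Tendsto (fun m : ℕ => (m : ℝ) + 1) Filter.atTop Filter.atTop :=
    Filter.tendsto_atTop_add_const_right _ _ tendsto_natCast_atTop_atTop
  have hm1 : ∀ᶠ m : ℕ in Filter.atTop,
      2 * (l : ℝ) / (m + 1) < ε - dist1v (fun i => (N i : ℝ) / l) φ :=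
    (hatTop.const_div_atTop _).eventually_lt_const hδ
  have hm2 : ∀ᶠ m : ℕ in Filter.atTop, -c < Real.log (π s) / (m + 1) - r / l := by
    have := (hatTop.const_div_atTop (Real.log (π s))).sub_const (r / l)
    exact this.eventually_const_lt (by linarith)
  refine Filter.le_liminf_of_le (by isBoundedDefault) ?_
  filter_upwards [hm1, hm2] with m h1 h2
  have hm0 : (0 : ℝ) < (m : ℝ) + 1 := by positivity
  have hpr := le_prEventA hπ ha ha1 (s := s) hl hN hΓN h1
  have hq : π s * Real.exp (-(((m : ℝ) + 1) * (r / l))) ≤ prEventA π a m Γ := by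
    refine le_trans (mul_le_mul_of_nonneg_left ?_ hs.le) hpr
    refine le_trans ?_ (pow_le_pow_left₀ (Real.exp_pos _).le hw _)
    rw [← Real.exp_nat_mul, Real.exp_le_exp]
    have h3 : ((m / l : ℕ) : ℝ) ≤ (m : ℝ) / l := Nat.cast_div_le
    have h4 : ((m / l : ℕ) : ℝ) * r ≤ (m : ℝ) / l * r := mul_le_mul_of_nonneg_right h3 hr
    have h5 : (m : ℝ) / l * r ≤ ((m : ℝ) + 1) * (r / l) := by
      rw [div_mul_eq_mul_div, mul_div_assoc]
      exact mul_le_mul_of_nonneg_right (by linarith) (by positivity)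
    linarith
  refine le_trans ?_ (le_mul_elog (inv_nonneg.2 hm0.le) (mul_pos hs (Real.exp_pos _)) hq)
  rw [EReal.coe_le_coe_iff, Real.log_mul hs.ne' (Real.exp_pos _).ne', Real.log_exp]
  have h6 : ((m : ℝ) + 1)⁻¹ * (Real.log (π s) + -(((m : ℝ) + 1) * (r / l))) =
      Real.log (π s) / (m + 1) - r / l := by
    field_simp
    ring
  rw [h6]
  exact h2.le

end LowerBound

section UpperBound

variable {n : ℕ} {a : Fin n → Fin n → ℝ}

theorem isCompact_of_closedInV {Γ : Set (Fin n → ℝ)} (hΓ : Γ ⊆ simplex n)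
    (hcl : ClosedInV (simplex n) Γ) : IsCompact Γ := by
  have hS : IsCompact (simplex n) := isCompact_stdSimplex ℝ (Fin n)
  refine hS.of_isClosed_subset (isClosed_of_closure_subset fun x hx => ?_) hΓ
  by_contra hxΓ
  obtain ⟨ε, hε, h⟩ := hcl x ⟨closure_minimal hΓ hS.isClosed hx, hxΓ⟩
  have hcont : Continuous fun ξ : Fin n → ℝ => dist1v ξ x := by
    unfold dist1v; fun_prop
  have hev : ∀ᶠ ξ in nhds x, dist1v ξ x < ε :=
    hcont.continuousAt.eventually_lt_const (by simpa [dist1v] using hε)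
  obtain ⟨ξ, hξ, hξε⟩ := ((mem_closure_iff_frequently.1 hx).and_eventually hev).exists
  exact (h ξ (hΓ hξ) hξε).2 hξ

theorem pathPA_nonneg {π : Fin n → ℝ} (hπ : ∀ i, 0 ≤ π i) (ha : ∀ i j, 0 ≤ a i j) {m : ℕ}
    (x : Fin (m + 1) → Fin n) : 0 ≤ pathPA π a x :=
  mul_nonneg (hπ _) (Finset.prod_nonneg fun _ _ => ha _ _)

/-- The exponential martingale bound on a half space. -/
theorem prEventA_halfSpace_le {π : Fin n → ℝ} (hπ : ∀ i, 0 ≤ π i) (ha : ∀ i j, 0 ≤ a i j)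
    (hrow : ∀ i, ∃ j, 0 < a i j) {u : Fin n → ℝ} (hu : ∀ i, 0 < u i) (c : ℝ) :
    ∃ C : ℝ, ∀ m : ℕ, prEventA π a m
      {φ | c < ∑ i, φ i * Real.log (u i / ∑ j, a i j * u j)} ≤
        C * Real.exp (-c * ((m : ℝ) + 1)) := by
  classical
  have hau : ∀ i, 0 < ∑ j, a i j * u j := fun i => by
    obtain ⟨j, hj⟩ := hrow i
    exact Finset.sum_pos' (fun k _ => mul_nonneg (ha i k) (hu k).le)
      ⟨j, Finset.mem_univ j, mul_pos hj (hu j)⟩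
  set θ : Fin n → ℝ := fun i => Real.log (u i / ∑ j, a i j * u j) with hθ
  have hexp : ∀ i, Real.exp (θ i) = u i / ∑ j, a i j * u j := fun i =>
    Real.exp_log (div_pos (hu i) (hau i))
  set B : Matrix (Fin n) (Fin n) ℝ := Matrix.of fun i j => Real.exp (θ i) * a i j with hB
  have hBu : B.mulVec u = u := by
    funext i
    simp only [hB, Matrix.mulVec, dotProduct, Matrix.of_apply, mul_assoc, ← Finset.mul_sum]
    rw [hexp, div_mul_cancel₀ _ (hau i).ne']
  have hBpow : ∀ m : ℕ, (B ^ m).mulVec u = u := fun m => by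
    induction m with
    | zero => simp
    | succ m ih => rw [pow_succ, ← Matrix.mulVec_mulVec, hBu, ih]
  set C₀ : ℝ := ∑ j, (∑ k, a j k * u k)⁻¹ with hC₀
  refine ⟨∑ i, π i * (C₀ * u i), fun m => ?_⟩
  rw [prEventA_eq, Finset.sum_mul]
  refine Finset.sum_le_sum fun i _ => ?_
  rw [mul_assoc]
  refine mul_le_mul_of_nonneg_left ?_ (hπ i)
  have hm0 : (0 : ℝ) < (m : ℝ) + 1 := by positivity
  refine (visitOp_pow_mono ha m (G := (C₀ * Real.exp (-c * ((m : ℝ) + 1))) •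
    fun j N => u j * Real.exp (∑ k, θ k * N k)) i 0 fun j N _ => ?_).trans ?_
  · rw [zero_add]
    simp only [Pi.smul_apply, smul_eq_mul]
    have hC₀j : (∑ k, a j k * u k)⁻¹ ≤ C₀ := Finset.single_le_sum
      (f := fun j => (∑ k, a j k * u k)⁻¹) (fun k _ => (inv_pos.2 (hau k)).le)
      (Finset.mem_univ j)
    have hC₀0 : 0 < C₀ := (inv_pos.2 (hau j)).trans_le hC₀j
    have huj := hu j
    split_ifs with hmem
    · have h1 : c * ((m : ℝ) + 1) < ∑ k, θ k * N k + θ j := by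
        have h2 : ∑ k, (((N + Pi.single j 1 : Fin n → ℕ) k : ℕ) : ℝ) / (m + 1) * θ k =
            (∑ k, θ k * N k + θ j) / (m + 1) := by
          rw [Finset.sum_congr rfl fun k _ => div_mul_eq_mul_div _ _ _, ← Finset.sum_div]
          congr 1
          simp [add_mul, Finset.sum_add_distrib, Pi.single_apply, mul_comm]
        have h3 : c < ∑ k, (((N + Pi.single j 1 : Fin n → ℕ) k : ℕ) : ℝ) / (m + 1) * θ k :=
          hmem
        rwa [h2, lt_div_iff₀ hm0] at h3
      have h4 : (1 : ℝ) ≤ Real.exp (-c * ((m : ℝ) + 1)) *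
          (Real.exp (∑ k, θ k * N k) * Real.exp (θ j)) := by
        rw [← Real.exp_add, ← Real.exp_add]
        exact Real.one_le_exp (by linarith)
      rw [hexp] at h4
      calc (1 : ℝ) ≤ _ := h4
        _ = (∑ k, a j k * u k)⁻¹ * (Real.exp (-c * ((m : ℝ) + 1)) *
            (u j * Real.exp (∑ k, θ k * N k))) := by
          rw [div_eq_mul_inv]; ring
        _ ≤ C₀ * (Real.exp (-c * ((m : ℝ) + 1)) * (u j * Real.exp (∑ k, θ k * N k))) :=
          mul_le_mul_of_nonneg_right hC₀j (by positivity)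
        _ = _ := by ring
    · positivity
  · rw [map_smul, Pi.smul_apply, Pi.smul_apply, visitOp_pow_exp, hBpow]
    simp only [Pi.zero_apply, Nat.cast_zero, mul_zero, Finset.sum_const_zero, Real.exp_zero,
      one_mul, smul_eq_mul]
    exact le_of_eq (by ring)

theorem prEventA_compact_le {π : Fin n → ℝ} (hπ : ∀ i, 0 ≤ π i) (ha : ∀ i j, 0 ≤ a i j)
    (hrow : ∀ i, ∃ j, 0 < a i j) {Γ : Set (Fin n → ℝ)} (hΓ : IsCompact Γ) {c : ℝ}
    (hc : ∀ φ ∈ Γ, (c : EReal) < rateCol a φ) :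
    ∃ C : ℝ, ∀ m : ℕ, prEventA π a m Γ ≤ C * Real.exp (-c * ((m : ℝ) + 1)) := by
  classical
  have hmono : ∀ (m : ℕ) (s t : Set (Fin n → ℝ)), s ⊆ t →
      prEventA π a m s ≤ prEventA π a m t := fun m s t hst => by
    refine Finset.sum_le_sum fun x _ => ?_
    have := pathPA_nonneg hπ ha x
    split_ifs with h1 h2 h2
    · exact le_rfl
    · exact absurd (hst h1) h2
    · exact this
    · exact le_rfl
  refine hΓ.induction_on (p := fun s => ∃ C : ℝ, ∀ m : ℕ,
    prEventA π a m s ≤ C * Real.exp (-c * ((m : ℝ) + 1))) ?_ ?_ ?_ ?_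
  · exact ⟨0, fun m => by simp [prEventA]⟩
  · rintro s t hst ⟨C, hC⟩
    exact ⟨C, fun m => (hmono m s t hst).trans (hC m)⟩
  · rintro s t ⟨C, hC⟩ ⟨C', hC'⟩
    refine ⟨C + C', fun m => ?_⟩
    rw [add_mul]
    refine le_trans ?_ (add_le_add (hC m) (hC' m))
    simp only [prEventA]
    rw [← Finset.sum_add_distrib]
    refine Finset.sum_le_sum fun x _ => ?_
    have := pathPA_nonneg hπ ha x
    by_cases h1 : emp1 x ∈ s <;> by_cases h2 : emp1 x ∈ t <;> simp [h1, h2, this]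
  · intro φ hφ
    have h := hc φ hφ
    rw [rateCol, lt_iSup_iff] at h
    obtain ⟨u, h⟩ := h
    obtain ⟨hu, h⟩ := lt_iSup_iff.1 h
    refine ⟨_, mem_nhdsWithin_of_mem_nhds ?_, prEventA_halfSpace_le hπ ha hrow hu c⟩
    refine IsOpen.mem_nhds (isOpen_lt continuous_const ?_) (by exact_mod_cast h)
    fun_prop

theorem ldp_upper_of_lt {π : Fin n → ℝ} (hπ : ∀ i, 0 ≤ π i) (ha : ∀ i j, 0 ≤ a i j)
    (hrow : ∀ i, ∃ j, 0 < a i j) {Γ : Set (Fin n → ℝ)} (hΓ : IsCompact Γ) {c : ℝ}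
    (hc : ∀ φ ∈ Γ, (c : EReal) < rateCol a φ) :
    Filter.limsup
      (fun m : ℕ => ((((m : ℝ) + 1)⁻¹ : ℝ) : EReal) * elog (prEventA π a m Γ))
      Filter.atTop ≤ ((-c : ℝ) : EReal) := by
  obtain ⟨C, hC⟩ := prEventA_compact_le hπ ha hrow hΓ hc
  have hC' : (0 : ℝ) < |C| + 1 := by positivity
  have hatTop : Filter.Tendsto (fun m : ℕ => (m : ℝ) + 1) Filter.atTop Filter.atTop :=
    Filter.tendsto_atTop_add_const_right _ _ tendsto_natCast_atTop_atTop
  have hlim : Filter.Tendsto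
      (fun m : ℕ => ((Real.log (|C| + 1) / ((m : ℝ) + 1) - c : ℝ) : EReal))
      Filter.atTop (nhds ((-c : ℝ) : EReal)) := by
    refine continuous_coe_real_ereal.continuousAt.tendsto.comp ?_
    simpa using (hatTop.const_div_atTop (Real.log (|C| + 1))).sub_const c
  rw [← hlim.limsup_eq]
  refine Filter.limsup_le_limsup (Filter.Eventually.of_forall fun m => ?_)
  have hm0 : (0 : ℝ) < (m : ℝ) + 1 := by positivity
  have hle : prEventA π a m Γ ≤ (|C| + 1) * Real.exp (-c * ((m : ℝ) + 1)) :=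
    (hC m).trans (mul_le_mul_of_nonneg_right (by linarith [le_abs_self C]) (Real.exp_pos _).le)
  refine (mul_elog_le (inv_pos.2 hm0) hle).trans (EReal.coe_le_coe_iff.2 (le_of_eq ?_))
  rw [Real.log_mul hC'.ne' (Real.exp_pos _).ne', Real.log_exp]
  field_simp
  ring

end UpperBound

/-- For a stationary Markov chain with irreducible state transition
matrix `A = [a_{ij}]` and stationary distribution `π`, the empirical singleton measures
satisfy the LDP with rate function `I(φ) = sup_{u>0} Σ_i φ_i log(u_i/(uᵀA)_i)`, and
this rate function also equals `sup_{u>0} Σ_i φ_i log(u_i/(Au)_i)`. -/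
theorem stmt15 {n : ℕ} (π : Fin n → ℝ) (a : Fin n → Fin n → ℝ)
    (hπ : π ∈ simplex n)
    (harow : ∀ i, (∀ j, 0 ≤ a i j) ∧ ∑ j, a i j = 1)
    (hinv : ∀ j, ∑ i, π i * a i j = π j)
    (hirr : ∀ i j, ∃ k : ℕ, 0 < ((Matrix.of a) ^ k) i j) :
    (∀ φ ∈ simplex n, rateRow a φ = rateCol a φ) ∧
    (∀ Γ : Set (Fin n → ℝ), Γ ⊆ simplex n → OpenInV (simplex n) Γ →
      -(⨅ φ ∈ Γ, rateRow a φ)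
        ≤ Filter.liminf
            (fun m : ℕ => ((((m:ℝ)+1)⁻¹ : ℝ) : EReal) * elog (prEventA π a m Γ))
            Filter.atTop) ∧
    (∀ Γ : Set (Fin n → ℝ), Γ ⊆ simplex n → ClosedInV (simplex n) Γ →
      Filter.limsup
          (fun m : ℕ => ((((m:ℝ)+1)⁻¹ : ℝ) : EReal) * elog (prEventA π a m Γ))
          Filter.atTop
        ≤ -(⨅ φ ∈ Γ, rateRow a φ)) := by
  obtain ⟨hπ0, hπ1⟩ := hπ
  have ha : ∀ i j, 0 ≤ a i j := fun i => (harow i).1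
  have ha1 : ∀ i, ∑ j, a i j = 1 := fun i => (harow i).2
  have hrow : ∀ i, ∃ j, 0 < a i j := fun i => by
    obtain ⟨j, -, hj⟩ := Finset.exists_lt_of_sum_lt (s := Finset.univ) (f := fun _ => (0 : ℝ))
      (g := a i) (by simp [ha1 i])
    exact ⟨j, hj⟩
  have hcol : ∀ j, ∃ i, 0 < a i j := fun j => by
    obtain ⟨i, hi⟩ := hrow j
    obtain ⟨k, hk⟩ := hirr i j
    by_contra! h
    have hzero : ∀ i, a i j = 0 := fun i => le_antisymm (h i) (ha i j)
    cases k with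
    | zero =>
      by_cases hij : i = j
      · rw [← hij] at hi
        exact absurd (hzero i) (hij ▸ hi.ne')
      · simp [hij] at hk
    | succ k => simp [pow_succ, Matrix.mul_apply, hzero] at hk
  have hrate : ∀ φ ∈ simplex n, rateRow a φ = rateCol a φ := fun φ hφ =>
    rateRow_eq_rateCol a ha hrow hcol hφ
  obtain ⟨s, -, hs⟩ := Finset.exists_lt_of_sum_lt (s := Finset.univ) (f := fun _ => (0 : ℝ))
    (g := π) (by simp [hπ1])
  refine ⟨hrate, fun Γ hΓ hopen => ?_, fun Γ hΓ hclosed => ?_⟩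
  · rw [EReal.neg_le]
    refine le_iInf₂ fun φ hφ => EReal.le_of_forall_lt_iff_le.1 fun c hc => ?_
    rw [EReal.neg_le, ← EReal.coe_neg]
    rw [hrate φ (hΓ hφ)] at hc
    exact ldp_lower_at hπ0 ha ha1 hirr hs hopen hφ (hΓ hφ) hc
  · rw [EReal.le_neg]
    refine EReal.ge_of_forall_gt_iff_ge.1 fun c hc => ?_
    rw [EReal.le_neg, ← EReal.coe_neg]
    refine ldp_upper_of_lt hπ0 ha hrow (isCompact_of_closedInV hΓ hclosed) fun φ hφ => ?_
    rw [← hrate φ (hΓ hφ)]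
    exact hc.trans_le (iInf₂_le φ hφ)
end
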